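/- arXiv:2308.04293 — 2 statements merged into one kernel-verified Lean document; each statement's English description precedes it below -/
import Mathlib

section
/- Let T be the Bolyai–Rényi map. For Lebesgue-almost every x ∈ [0,1), for each i ∈ {1,2,3} the digit frequency f_i(x) = lim_{n→∞} (1/n)·#{1 ≤ k ≤ n : T^{k−1}(x) ∈ I_i} exists and satisfies |f₁(x) − 0.46407962944716719166021454266242962642460872990983| ≤ 10⁻⁵⁰, |f₂(x) − 0.30441904494046044774395954980142705829742520632111| ≤ 10⁻⁵⁰, and |f₃(x) − 0.23150132561237236059582590753614331527796606376905| ≤ 10⁻⁵⁰. -/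
open MeasureTheory Real Filter

/-- The Bolyai–Rényi map. -/
noncomputable def T (x : ℝ) : ℝ :=
  if x < Real.sqrt 2 - 1 then x ^ 2 + 2 * x
  else if x < Real.sqrt 3 - 1 then x ^ 2 + 2 * x - 1
  else x ^ 2 + 2 * x - 2

/-- The digit intervals of the Bolyai–Rényi map. -/
def I1 : Set ℝ := Set.Ico 0 (Real.sqrt 2 - 1)
def I2 : Set ℝ := Set.Ico (Real.sqrt 2 - 1) (Real.sqrt 3 - 1)
def I3 : Set ℝ := Set.Ico (Real.sqrt 3 - 1) 1

open Classical in
/-- `freq x S n` is `(1/n) · #{0 ≤ k < n : T^k(x) ∈ S}`. -/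
noncomputable def freq (x : ℝ) (S : Set ℝ) (n : ℕ) : ℝ :=
  (∑ k ∈ Finset.range n, if T^[k] x ∈ S then (1 : ℝ) else 0) / n

namespace BR

/-- The working interval. -/
def J : Set ℝ := Set.Ico 0 1

/-- Lipschitz on the working interval. -/
def LipJ (K : ℝ) (f : ℝ → ℝ) : Prop := ∀ x ∈ J, ∀ y ∈ J, |f x - f y| ≤ K * |x - y|

/-- Branch of the transfer operator. -/
noncomputable def op (i : ℝ) (f : ℝ → ℝ) (y : ℝ) : ℝ :=
  f (√(y + i) - 1) / (2 * √(y + i))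

/-- The transfer operator. -/
noncomputable def L (f : ℝ → ℝ) (y : ℝ) : ℝ := op 1 f y + op 2 f y + op 3 f y

lemma phi_mem {i y : ℝ} (hi1 : 1 ≤ i) (hi3 : i ≤ 3) (hy : y ∈ J) : √(y + i) - 1 ∈ J := by
  obtain ⟨h0, h1⟩ := hy
  constructor
  · have : 1 ≤ √(y + i) := by
      rw [Real.one_le_sqrt]; linarith
    linarith
  · have : √(y + i) < 2 := by
      rw [Real.sqrt_lt' (by norm_num)]; linarith
    linarith

lemma sqrt_diff {i s y z : ℝ} (hs : 0 < s) (hsi : s ^ 2 ≤ i) (hy : y ∈ J) (hz : z ∈ J) :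
    |√(y + i) - √(z + i)| ≤ |y - z| / (2 * s) := by
  obtain ⟨hy0, _⟩ := hy
  obtain ⟨hz0, _⟩ := hz
  have a1 : s ≤ √(y + i) := Real.le_sqrt_of_sq_le (by linarith)
  have a2 : s ≤ √(z + i) := Real.le_sqrt_of_sq_le (by linarith)
  have b1 : √(y + i) ^ 2 = y + i := Real.sq_sqrt (by nlinarith)
  have b2 : √(z + i) ^ 2 = z + i := Real.sq_sqrt (by nlinarith)
  rw [le_div_iff₀ (by linarith)]
  have : y - z = (√(y + i) - √(z + i)) * (√(y + i) + √(z + i)) := by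
    nlinarith
  rw [this, abs_mul]
  apply mul_le_mul_of_nonneg_left _ (abs_nonneg _)
  rw [abs_of_nonneg] <;> linarith

lemma op_lip {i s K A : ℝ} {f : ℝ → ℝ} (hi1 : 1 ≤ i) (hi3 : i ≤ 3) (hs : 0 < s) (hsi : s ^ 2 ≤ i)
    (hK : 0 ≤ K) (hA : 0 ≤ A) (hf : LipJ K f) (hb : ∀ x ∈ J, |f x| ≤ A) :
    LipJ (K / (4 * s ^ 2) + A / (4 * s ^ 3)) (op i f) := by
  intro y hy z hz
  have hd := sqrt_diff hs hsi hy hz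
  have a1 : s ≤ √(y + i) := Real.le_sqrt_of_sq_le (by linarith [hy.1])
  have a2 : s ≤ √(z + i) := Real.le_sqrt_of_sq_le (by linarith [hz.1])
  have h1 := hf _ (phi_mem hi1 hi3 hy) _ (phi_mem hi1 hi3 hz)
  have h2 := hb _ (phi_mem hi1 hi3 hz)
  unfold op
  set a := √(y + i)
  set b := √(z + i)
  have ha : 0 < a := by linarith
  have hb' : 0 < b := by linarith
  have e : f (a - 1) / (2 * a) - f (b - 1) / (2 * b)
      = (f (a - 1) - f (b - 1)) / (2 * a) + f (b - 1) * ((b - a) / (2 * a * b)) := by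
    field_simp; ring
  rw [e]
  refine (abs_add_le _ _).trans ?_
  rw [abs_mul (f (b - 1)), abs_div, abs_div, abs_of_pos (show 0 < 2 * a by positivity),
    abs_of_pos (show 0 < 2 * a * b by positivity), abs_sub_comm b a]
  have h1' : |f (a - 1) - f (b - 1)| ≤ K * (|y - z| / (2 * s)) := by
    refine h1.trans (mul_le_mul_of_nonneg_left ?_ hK)
    simpa using hd
  have t1 : |f (a - 1) - f (b - 1)| / (2 * a) ≤ K * (|y - z| / (2 * s)) / (2 * s) := by
    gcongr
  have t2 : |f (b - 1)| * (|a - b| / (2 * a * b)) ≤ A * ((|y - z| / (2 * s)) / (2 * s * s)) := by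
    gcongr
  refine (add_le_add t1 t2).trans (le_of_eq ?_)
  field_simp
  ring

lemma LipJ.mono {K K' : ℝ} {f : ℝ → ℝ} (h : LipJ K f) (hk : K ≤ K') : LipJ K' f := by
  intro x hx y hy
  exact (h x hx y hy).trans (mul_le_mul_of_nonneg_right hk (abs_nonneg _))

lemma LipJ.add {K K' : ℝ} {f g : ℝ → ℝ} (h : LipJ K f) (h' : LipJ K' g) :
    LipJ (K + K') (fun x => f x + g x) := by
  intro x hx y hy
  have := h x hx y hy
  have := h' x hx y hy
  calc |f x + g x - (f y + g y)| = |(f x - f y) + (g x - g y)| := by ring_nf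
    _ ≤ _ := abs_add_le _ _
    _ ≤ _ := by linarith

lemma LipJ.const_mul {K : ℝ} {f : ℝ → ℝ} (h : LipJ K f) (c : ℝ) :
    LipJ (|c| * K) (fun x => c * f x) := by
  intro x hx y hy
  have := h x hx y hy
  rw [← mul_sub, abs_mul, mul_assoc]
  exact mul_le_mul_of_nonneg_left this (abs_nonneg _)

lemma LipJ.sub_const {K : ℝ} {f : ℝ → ℝ} (h : LipJ K f) (c : ℝ) :
    LipJ K (fun x => f x - c) := by
  intro x hx y hy
  simpa using h x hx y hy

lemma LipJ.congr {K : ℝ} {f g : ℝ → ℝ} (h : LipJ K f) (e : ∀ x ∈ J, g x = f x) : LipJ K g := by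
  intro x hx y hy
  rw [e x hx, e y hy]; exact h x hx y hy

lemma L_lip {K A : ℝ} {f : ℝ → ℝ} (hK : 0 ≤ K) (hA : 0 ≤ A) (hf : LipJ K f)
    (hb : ∀ x ∈ J, |f x| ≤ A) : LipJ (0.46 * K + 0.39 * A) (L f) := by
  have h1 := op_lip (i := 1) (s := 1) (by norm_num) (by norm_num) (by norm_num) (by norm_num)
    hK hA hf hb
  have h2 := op_lip (i := 2) (s := 1.41) (by norm_num) (by norm_num) (by norm_num) (by norm_num)
    hK hA hf hb
  have h3 := op_lip (i := 3) (s := 1.73) (by norm_num) (by norm_num) (by norm_num) (by norm_num)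
    hK hA hf hb
  refine LipJ.mono ((h1.add h2).add h3) ?_
  norm_num
  linarith

/-- Reference measure. -/
noncomputable abbrev mu : Measure ℝ := volume.restrict J

lemma measJ : MeasurableSet J := measurableSet_Ico

instance : IsProbabilityMeasure mu := ⟨by simp [mu, J]⟩

lemma integrable_of_bdd {f : ℝ → ℝ} {A : ℝ} (hm : Measurable f) (hb : ∀ x ∈ J, |f x| ≤ A) :
    Integrable f mu := by
  refine Integrable.of_bound hm.aestronglyMeasurable A ?_
  filter_upwards [ae_restrict_mem measJ] with x hx
  exact hb x hx

lemma op_meas (i : ℝ) {f : ℝ → ℝ} (hf : Measurable f) : Measurable (op i f) := by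
  unfold op
  fun_prop

lemma L_meas {f : ℝ → ℝ} (hf : Measurable f) : Measurable (L f) := by
  unfold L
  exact ((op_meas 1 hf).add (op_meas 2 hf)).add (op_meas 3 hf)

lemma Lit_meas {f : ℝ → ℝ} (hf : Measurable f) (n : ℕ) : Measurable (L^[n] f) := by
  induction n with
  | zero => exact hf
  | succ n ih => rw [Function.iterate_succ_apply']; exact L_meas ih

lemma op_bdd {i A : ℝ} {f : ℝ → ℝ} (hi1 : 1 ≤ i) (hi3 : i ≤ 3) (hb : ∀ x ∈ J, |f x| ≤ A) :
    ∀ x ∈ J, |op i f x| ≤ A := by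
  intro x hx
  have h := hb _ (phi_mem hi1 hi3 hx)
  unfold op
  have h1 : 1 ≤ √(x + i) := by rw [Real.one_le_sqrt]; linarith [hx.1]
  rw [abs_div, abs_of_pos (show 0 < 2 * √(x + i) by positivity)]
  refine (div_le_self (abs_nonneg _) (by linarith)).trans h

lemma L_bdd {A : ℝ} {f : ℝ → ℝ} (hb : ∀ x ∈ J, |f x| ≤ A) : ∀ x ∈ J, |L f x| ≤ 3 * A := by
  intro x hx
  have h1 := op_bdd (i := 1) (by norm_num) (by norm_num) hb x hx
  have h2 := op_bdd (i := 2) (by norm_num) (by norm_num) hb x hx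
  have h3 := op_bdd (i := 3) (by norm_num) (by norm_num) hb x hx
  unfold L
  have := abs_add_le (op 1 f x + op 2 f x) (op 3 f x)
  have := abs_add_le (op 1 f x) (op 2 f x)
  linarith

lemma Lit_bdd {A : ℝ} {f : ℝ → ℝ} (hb : ∀ x ∈ J, |f x| ≤ A) (n : ℕ) :
    ∀ x ∈ J, |L^[n] f x| ≤ 3 ^ n * A := by
  induction n with
  | zero => simpa using hb
  | succ n ih =>
    rw [Function.iterate_succ_apply']
    intro x hx
    have := L_bdd ih x hx
    rw [pow_succ]; linarith

/-- digit cell -/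
def cell (i : ℝ) : Set ℝ := Set.Ico (√i - 1) (√(i + 1) - 1)

lemma image_phi {i : ℝ} (hi1 : 1 ≤ i) : (fun y => √(y + i) - 1) '' J = cell i := by
  ext x
  constructor
  · rintro ⟨y, ⟨h0, h1⟩, rfl⟩
    constructor
    · have : √i ≤ √(y + i) := Real.sqrt_le_sqrt (by linarith)
      simpa using this
    · have : √(y + i) < √(i + 1) := Real.sqrt_lt_sqrt (by linarith) (by linarith)
      simpa using this
  · rintro ⟨h0, h1⟩
    have hs : 1 ≤ √i := by rw [Real.one_le_sqrt]; exact hi1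
    have e1 : √i ^ 2 = i := Real.sq_sqrt (by linarith)
    have e2 : √(i + 1) ^ 2 = i + 1 := Real.sq_sqrt (by linarith)
    refine ⟨(x + 1) ^ 2 - i, ⟨?_, ?_⟩, ?_⟩
    · nlinarith
    · nlinarith
    · simp only [sub_add_cancel]
      rw [Real.sqrt_sq (by linarith)]; ring

lemma integral_cell {i : ℝ} (hi1 : 1 ≤ i) (F : ℝ → ℝ) :
    ∫ x in cell i, F x = ∫ y in J, F (√(y + i) - 1) / (2 * √(y + i)) := by
  rw [← image_phi hi1]
  rw [integral_image_eq_integral_abs_deriv_smul (f' := fun y => 1 / (2 * √(y + i))) measJ]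
  · apply setIntegral_congr_fun measJ
    intro y hy
    have : 0 ≤ 1 / (2 * √(y + i)) := by positivity
    simp only [abs_of_nonneg this, smul_eq_mul]
    ring
  · intro y hy
    have h : y + i ≠ 0 := by have := hy.1; linarith
    have := (((hasDerivAt_id y).add_const i).sqrt h).sub_const 1
    exact this.hasDerivWithinAt
  · intro a ha b hb hab
    simp only [sub_left_inj] at hab
    have := (Real.sqrt_inj (by linarith [ha.1]) (by linarith [hb.1])).1 hab
    linarith

lemma s2 : (1.41 : ℝ) < √2 ∧ √2 < 1.42 := by
  constructor
  · exact Real.lt_sqrt_of_sq_lt (by norm_num)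
  · rw [Real.sqrt_lt' (by norm_num)]; norm_num
lemma s3 : (1.73 : ℝ) < √3 ∧ √3 < 1.74 := by
  constructor
  · exact Real.lt_sqrt_of_sq_lt (by norm_num)
  · rw [Real.sqrt_lt' (by norm_num)]; norm_num
lemma s4 : √4 = (2 : ℝ) := by
  rw [show (4 : ℝ) = 2 ^ 2 by norm_num]; exact Real.sqrt_sq (by norm_num)

lemma cell1 : cell 1 = I1 := by simp [cell, I1]; norm_num
lemma cell2 : cell 2 = I2 := by simp [cell, I2]; norm_num
lemma cell3 : cell 3 = I3 := by
  simp only [cell, I3]; rw [show (3 : ℝ) + 1 = 4 by norm_num, s4]; norm_num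

lemma J_union : J = (I1 ∪ I2) ∪ I3 := by
  have := s2; have := s3
  rw [I1, I2, I3, Set.Ico_union_Ico_eq_Ico, Set.Ico_union_Ico_eq_Ico] <;> first | rfl | linarith

lemma T1 {x : ℝ} (h : x ∈ I1) : T x = x ^ 2 + 2 * x := by
  simp [T, h.2]
lemma T2 {x : ℝ} (h : x ∈ I2) : T x = x ^ 2 + 2 * x - 1 := by
  simp [T, h.2, not_lt.2 h.1]
lemma T3 {x : ℝ} (h : x ∈ I3) : T x = x ^ 2 + 2 * x - 2 := by
  have := s2; have := s3
  have h1 := h.1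
  simp [T, not_lt.2 h.1, not_lt.2 (show √2 - 1 ≤ x by linarith)]

lemma T_meas : Measurable T := by
  unfold T
  refine Measurable.ite (measurableSet_lt measurable_id measurable_const) (by fun_prop) ?_
  exact Measurable.ite (measurableSet_lt measurable_id measurable_const) (by fun_prop) (by fun_prop)

lemma Tit_meas (n : ℕ) : Measurable (T^[n]) := T_meas.iterate n

lemma phi_cell {i y : ℝ} (hi1 : 1 ≤ i) (hy : y ∈ J) : √(y + i) - 1 ∈ cell i := by
  rw [← image_phi hi1]; exact ⟨y, hy, rfl⟩

lemma phi_quad {i y : ℝ} (hi1 : 1 ≤ i) (hy : y ∈ J) :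
    (√(y + i) - 1) ^ 2 + 2 * (√(y + i) - 1) = y + i - 1 := by
  have := Real.sq_sqrt (show 0 ≤ y + i by linarith [hy.1])
  nlinarith

lemma T_phi1 {y : ℝ} (hy : y ∈ J) : T (√(y + 1) - 1) = y := by
  rw [T1 (cell1 ▸ phi_cell le_rfl hy), phi_quad le_rfl hy]; ring
lemma T_phi2 {y : ℝ} (hy : y ∈ J) : T (√(y + 2) - 1) = y := by
  rw [T2 (cell2 ▸ phi_cell (by norm_num) hy), phi_quad (by norm_num) hy]; ring
lemma T_phi3 {y : ℝ} (hy : y ∈ J) : T (√(y + 3) - 1) = y := by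
  rw [T3 (cell3 ▸ phi_cell (by norm_num) hy), phi_quad (by norm_num) hy]; ring

lemma dual {f g : ℝ → ℝ} {A B : ℝ} (hf : Measurable f) (hg : Measurable g)
    (hfb : ∀ x ∈ J, |f x| ≤ A) (hgb : ∀ x, |g x| ≤ B) :
    ∫ x, f x * g (T x) ∂mu = ∫ x, L f x * g x ∂mu := by
  have hgi : Integrable (fun x => f x * g (T x)) mu := by
    apply integrable_of_bdd (A := A * B) (hf.mul (hg.comp T_meas))
    intro x hx
    change |f x * g (T x)| ≤ A * B
    rw [abs_mul]
    exact mul_le_mul (hfb x hx) (hgb _) (abs_nonneg _) ((abs_nonneg _).trans (hfb x hx))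
  have hio : ∀ i : ℝ, 1 ≤ i → i ≤ 3 → Integrable (fun x => op i f x * g x) mu := by
    intro i h1 h3
    apply integrable_of_bdd (A := A * B) ((op_meas i hf).mul hg)
    intro x hx
    change |op i f x * g x| ≤ A * B
    rw [abs_mul]
    have h := op_bdd h1 h3 hfb x hx
    exact mul_le_mul h (hgb _) (abs_nonneg _) ((abs_nonneg _).trans h)
  have hI1 : MeasurableSet I1 := measurableSet_Ico
  have hI2 : MeasurableSet I2 := measurableSet_Ico
  have hI3 : MeasurableSet I3 := measurableSet_Ico
  have hs2 := s2
  have hs3 := s3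
  have d12 : Disjoint I1 I2 := by
    rw [Set.disjoint_left]; intro x h h'; exact absurd h.2 (not_lt.2 h'.1)
  have d3 : Disjoint (I1 ∪ I2) I3 := by
    rw [Set.disjoint_left]
    rintro x (h | h) h'
    · have := h.2; have := h'.1; linarith
    · have := h.2; have := h'.1; linarith
  have hI : IntegrableOn (fun x => f x * g (T x)) ((I1 ∪ I2) ∪ I3) := by
    rw [← J_union]; exact hgi
  have hc : ∀ i : ℝ, 1 ≤ i → (∀ y ∈ J, T (√(y + i) - 1) = y) →
      ∫ x in cell i, f x * g (T x) = ∫ x, op i f x * g x ∂mu := by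
    intro i h1 hT
    rw [integral_cell h1]
    apply setIntegral_congr_fun measJ
    intro y hy
    simp only [hT y hy, op]
    ring
  calc ∫ x, f x * g (T x) ∂mu = ∫ x in (I1 ∪ I2) ∪ I3, f x * g (T x) := by rw [← J_union]
    _ = (∫ x in I1, f x * g (T x)) + (∫ x in I2, f x * g (T x)) + ∫ x in I3, f x * g (T x) := by
      rw [setIntegral_union d3 hI3 hI.left_of_union hI.right_of_union,
        setIntegral_union d12 hI2 hI.left_of_union.left_of_union hI.left_of_union.right_of_union]
    _ = _ := by
      rw [← cell1, ← cell2, ← cell3, hc 1 le_rfl fun y => T_phi1,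
        hc 2 (by norm_num) fun y => T_phi2, hc 3 (by norm_num) fun y => T_phi3]
      rw [← integral_add (hio 1 le_rfl (by norm_num)) (hio 2 (by norm_num) (by norm_num)),
        ← integral_add _ (hio 3 (by norm_num) (by norm_num))]
      · congr 1; ext x; simp only [L]; ring
      · exact (hio 1 le_rfl (by norm_num)).add (hio 2 (by norm_num) (by norm_num))

lemma L_lin (a b : ℝ) (f g : ℝ → ℝ) :
    L (fun x => a * f x + b * g x) = fun y => a * L f y + b * L g y := by
  ext y; simp only [L, op]; ring

lemma Lit_lin (a b : ℝ) (f g : ℝ → ℝ) (n : ℕ) :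
    L^[n] (fun x => a * f x + b * g x) = fun y => a * L^[n] f y + b * L^[n] g y := by
  induction n with
  | zero => rfl
  | succ n ih => rw [Function.iterate_succ_apply', ih, L_lin, Function.iterate_succ_apply',
      Function.iterate_succ_apply']

lemma dual_iter {g : ℝ → ℝ} {B : ℝ} (hg : Measurable g) (hgb : ∀ x, |g x| ≤ B) (n : ℕ) :
    ∀ {f : ℝ → ℝ} {A : ℝ}, Measurable f → (∀ x ∈ J, |f x| ≤ A) →
    ∫ x, f x * g (T^[n] x) ∂mu = ∫ x, L^[n] f x * g x ∂mu := by
  induction n with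
  | zero => intros; rfl
  | succ n ih =>
    intro f A hf hfb
    simp only [Function.iterate_succ_apply]
    rw [← ih (L_meas hf) (L_bdd hfb)]
    exact dual hf (hg.comp (Tit_meas n)) hfb (fun x => hgb _)

lemma mean_L {f : ℝ → ℝ} {A : ℝ} (hf : Measurable f) (hfb : ∀ x ∈ J, |f x| ≤ A) :
    ∫ x, L f x ∂mu = ∫ x, f x ∂mu := by
  have := dual (g := fun _ => 1) (B := 1) hf measurable_const hfb (by simp)
  simpa using this.symm

lemma LipJ.bdd {f : ℝ → ℝ} {K : ℝ} (hK : 0 ≤ K) (h : LipJ K f) : ∀ x ∈ J, |f x| ≤ |f 0| + K := by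
  intro x hx
  have h1 := h x hx 0 ⟨le_rfl, zero_lt_one⟩
  have h2 : |x - 0| ≤ 1 := by rw [sub_zero, abs_of_nonneg hx.1]; exact hx.2.le
  have h3 : |f x| ≤ |f 0| + |f x - f 0| := by
    have := abs_add_le (f 0) (f x - f 0)
    simpa using this
  nlinarith

lemma LipJ.near_mean {f : ℝ → ℝ} {K : ℝ} (hK : 0 ≤ K) (hm : Measurable f) (h : LipJ K f) :
    ∀ x ∈ J, |f x - ∫ y, f y ∂mu| ≤ K := by
  intro x hx
  have hi := integrable_of_bdd hm (h.bdd hK)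
  have e : f x - ∫ y, f y ∂mu = ∫ y, (f x - f y) ∂mu := by
    rw [integral_sub (integrable_const _) hi]; simp
  rw [e]
  have : ‖∫ y, (f x - f y) ∂mu‖ ≤ K * (mu.real Set.univ) := by
    apply norm_integral_le_of_norm_le_const
    filter_upwards [ae_restrict_mem measJ] with y hy
    have h1 := h x hx y hy
    have h2 : |x - y| ≤ 1 := by
      rw [abs_le]; constructor <;> linarith [hx.1, hx.2, hy.1, hy.2]
    rw [Real.norm_eq_abs]
    nlinarith
  simpa using this

lemma zero_step {f : ℝ → ℝ} {K : ℝ} (hK : 0 ≤ K) (hm : Measurable f) (h : LipJ K f)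
    (h0 : ∫ y, f y ∂mu = 0) : LipJ (0.85 * K) (L f) := by
  have hb := h.near_mean hK hm
  rw [h0] at hb
  simp only [sub_zero] at hb
  exact (L_lip hK hK h hb).mono (by linarith)

lemma zero_iter {f : ℝ → ℝ} {K : ℝ} (hK : 0 ≤ K) (hm : Measurable f) (h : LipJ K f)
    (h0 : ∫ y, f y ∂mu = 0) (n : ℕ) :
    LipJ (0.85 ^ n * K) (L^[n] f) ∧ ∫ y, L^[n] f y ∂mu = 0 := by
  induction n with
  | zero => simpa using ⟨h, h0⟩
  | succ n ih =>
    rw [Function.iterate_succ_apply']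
    have hk : 0 ≤ 0.85 ^ n * K := by positivity
    constructor
    · have := zero_step hk (Lit_meas hm n) ih.1 ih.2
      rw [pow_succ]
      exact this.mono (by linarith)
    · rw [mean_L (Lit_meas hm n) (ih.1.bdd hk), ih.2]

lemma zero_bdd {f : ℝ → ℝ} {K : ℝ} (hK : 0 ≤ K) (hm : Measurable f) (h : LipJ K f)
    (h0 : ∫ y, f y ∂mu = 0) (n : ℕ) : ∀ x ∈ J, |L^[n] f x| ≤ 0.85 ^ n * K := by
  have hz := zero_iter hK hm h h0 n
  have := hz.1.near_mean (by positivity) (Lit_meas hm n)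
  rw [hz.2] at this
  simpa using this

lemma int_bound {f g : ℝ → ℝ} {A : ℝ} (hf : ∀ x ∈ J, |f x| ≤ A) (hg : ∀ x, |g x| ≤ 1) :
    |∫ x, f x * g x ∂mu| ≤ A := by
  have : ‖∫ x, f x * g x ∂mu‖ ≤ A * (mu.real Set.univ) := by
    apply norm_integral_le_of_norm_le_const
    filter_upwards [ae_restrict_mem measJ] with x hx
    rw [Real.norm_eq_abs, abs_mul]
    have := hf x hx
    have := hg x
    nlinarith [abs_nonneg (f x), abs_nonneg (g x)]
  simpa using this

/-- The constant function one. -/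
def one : ℝ → ℝ := fun _ => 1

lemma one_meas : Measurable one := measurable_const

lemma one_iter (n : ℕ) : LipJ 3 (L^[n] one) ∧ ∫ y, L^[n] one y ∂mu = 1 := by
  induction n with
  | zero =>
    refine ⟨?_, by simp [one]⟩
    intro x _ y _
    simp only [Function.iterate_zero, id, one, sub_self, abs_zero]; positivity
  | succ n ih =>
    rw [Function.iterate_succ_apply']
    have hm := Lit_meas one_meas n
    constructor
    · have hb := ih.1.near_mean (by norm_num) hm
      rw [ih.2] at hb
      refine (L_lip (A := 4) (by norm_num) (by norm_num) ih.1 ?_).mono (by norm_num)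
      intro x hx
      have := hb x hx
      rw [abs_le] at this ⊢
      constructor <;> linarith
    · rw [mean_L hm (ih.1.bdd (by norm_num)), ih.2]

lemma one_bdd (n : ℕ) : ∀ x ∈ J, |L^[n] one x| ≤ 4 := by
  have ih := one_iter n
  intro x hx
  have := ih.1.near_mean (by norm_num) (Lit_meas one_meas n) x hx
  rw [ih.2] at this
  rw [abs_le] at this ⊢
  constructor <;> linarith

/-- indicator function -/
noncomputable def ind (I : Set ℝ) : ℝ → ℝ := I.indicator (fun _ => 1)

lemma ind_meas {I : Set ℝ} (hI : MeasurableSet I) : Measurable (ind I) :=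
  measurable_const.indicator hI

lemma ind_01 (I : Set ℝ) (x : ℝ) : 0 ≤ ind I x ∧ ind I x ≤ 1 := by
  unfold ind
  by_cases h : x ∈ I <;> simp [h]

lemma ind_abs (I : Set ℝ) (x : ℝ) : |ind I x| ≤ 1 := by
  have := ind_01 I x
  rw [abs_le]; constructor <;> linarith

/-- Sets on which restriction followed by `L` preserves the Lipschitz class. -/
def Good (I : Set ℝ) : Prop := MeasurableSet I ∧ ∀ (u : ℝ → ℝ), LipJ 3 u →
  (∀ x ∈ J, |u x| ≤ 4) → LipJ 2 (L (fun x => ind I x * u x))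

/-- mass of the digit cell after `n` steps -/
noncomputable def mass (I : Set ℝ) (n : ℕ) : ℝ := ∫ x, L^[n] one x * ind I x ∂mu

lemma mass_01 {I : Set ℝ} (hI : MeasurableSet I) (n : ℕ) : 0 ≤ mass I n ∧ mass I n ≤ 1 := by
  have e : mass I n = ∫ x, one x * ind I (T^[n] x) ∂mu :=
    (dual_iter (ind_meas hI) (ind_abs I) n one_meas (A := 1) (by simp [one])).symm
  rw [e]
  have hi : Integrable (fun x => ind I (T^[n] x)) mu :=
    integrable_of_bdd (A := 1) ((ind_meas hI).comp (Tit_meas n)) (fun x _ => ind_abs I _)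
  simp only [one, one_mul]
  constructor
  · exact integral_nonneg fun x => (ind_01 I _).1
  · calc ∫ x, ind I (T^[n] x) ∂mu ≤ ∫ _, (1 : ℝ) ∂mu :=
        integral_mono hi (integrable_const _) fun x => (ind_01 I _).2
      _ = 1 := by simp

lemma intg {f g : ℝ → ℝ} {A : ℝ} (hf : Measurable f) (hfb : ∀ x ∈ J, |f x| ≤ A)
    (hg : Measurable g) (hgb : ∀ x, |g x| ≤ 1) : Integrable (fun x => f x * g x) mu := by
  apply integrable_of_bdd (A := A) (hf.mul hg)
  intro x hx
  change |f x * g x| ≤ A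
  rw [abs_mul]
  have := hfb x hx
  have := hgb x
  nlinarith [abs_nonneg (f x), abs_nonneg (g x)]

/-- difference of two mean-one functions -/
lemma diff_bdd {f p : ℝ → ℝ} {K Kp : ℝ} (hK : 0 ≤ K) (hf : Measurable f) (hfl : LipJ K f)
    (hKp : 0 ≤ Kp) (hp : Measurable p) (hpl : LipJ Kp p)
    (h1 : ∫ y, f y ∂mu = ∫ y, p y ∂mu) (n : ℕ) :
    ∀ x ∈ J, |L^[n] f x - L^[n] p x| ≤ 0.85 ^ n * (K + Kp) := by
  have hm : Measurable (fun x => 1 * f x + (-1) * p x) := by fun_prop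
  have hl : LipJ (|(1 : ℝ)| * K + |(-1 : ℝ)| * Kp) (fun x => 1 * f x + (-1) * p x) :=
    (hfl.const_mul 1).add (hpl.const_mul (-1))
  have hz : ∫ y, (1 * f y + (-1) * p y) ∂mu = 0 := by
    have hi := integrable_of_bdd hf (hfl.bdd hK)
    have hi' := integrable_of_bdd hp (hpl.bdd hKp)
    rw [integral_add (hi.const_mul 1) (hi'.const_mul (-1)), integral_const_mul, integral_const_mul,
      h1]
    ring
  have := zero_bdd (by positivity) hm hl hz n
  rw [Lit_lin] at this
  intro x hx
  have h := this x hx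
  simp only [abs_one, abs_neg, one_mul] at h
  convert h using 2
  ring

lemma mass_step {I : Set ℝ} (hI : MeasurableSet I) (n : ℕ) :
    dist (mass I n) (mass I (n + 1)) ≤ 6 * 0.85 ^ n := by
  have h1 := one_iter 1
  have h0 := one_iter 0
  have hb := diff_bdd (by norm_num) (Lit_meas one_meas 0) h0.1 (by norm_num) (Lit_meas one_meas 1)
    h1.1 (by rw [h0.2, h1.2]) n
  have hb' : ∀ x ∈ J, |L^[n] one x - L^[n + 1] one x| ≤ 6 * 0.85 ^ n := by
    intro x hx
    have := hb x hx
    simp only [← Function.iterate_add_apply] at this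
    norm_num at this ⊢
    linarith
  rw [Real.dist_eq, mass, mass, ← integral_sub (intg (Lit_meas one_meas n) (one_bdd n) (ind_meas hI)
    (ind_abs I)) (intg (Lit_meas one_meas (n + 1)) (one_bdd (n + 1)) (ind_meas hI) (ind_abs I))]
  have := int_bound hb' (ind_abs I)
  simpa only [sub_mul] using this

lemma mass_lim {I : Set ℝ} (hI : MeasurableSet I) : ∃ c, Tendsto (mass I) atTop (nhds c) := by
  apply cauchySeq_tendsto_of_complete
  exact cauchySeq_of_le_geometric (0.85 : ℝ) 6 (by norm_num) (mass_step hI)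

lemma approx_bdd {p : ℝ → ℝ} {Kp Kr : ℝ} (hp : Measurable p) (hKp : 0 ≤ Kp) (hKr : 0 ≤ Kr)
    (hpl : LipJ Kp p) (hr : LipJ Kr (fun x => L p x - p x)) (n : ℕ) :
    ∀ x ∈ J, |L^[n] p x - p x| ≤ (∑ k ∈ Finset.range n, 0.85 ^ k) * Kr := by
  have hi := integrable_of_bdd hp (hpl.bdd hKp)
  have hLi := integrable_of_bdd (L_meas hp) (L_bdd (hpl.bdd hKp))
  have hz : ∫ y, (1 * L p y + (-1) * p y) ∂mu = 0 := by
    rw [integral_add (hLi.const_mul 1) (hi.const_mul (-1)), integral_const_mul, integral_const_mul,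
      mean_L hp (hpl.bdd hKp)]
    ring
  have hr' : LipJ Kr (fun x => 1 * L p x + (-1) * p x) := hr.congr (fun x _ => by ring)
  have hm : Measurable (fun x => 1 * L p x + (-1) * p x) := by
    have := L_meas hp
    fun_prop
  intro x hx
  induction n with
  | zero => simp
  | succ n ih =>
    have h := zero_bdd hKr hm hr' hz n x hx
    rw [Lit_lin, ← Function.iterate_succ_apply] at h
    rw [Finset.sum_range_succ, add_mul]
    have e : L^[n + 1] p x - p x =
      (L^[n] p x - p x) + (1 * L^[n + 1] p x + -1 * L^[n] p x) := by ring
    rw [e]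
    exact (abs_add_le _ _).trans (add_le_add ih h)

lemma mass_approx {I : Set ℝ} (hI : MeasurableSet I) {c : ℝ}
    (hc : Tendsto (mass I) atTop (nhds c)) {p : ℝ → ℝ} {Kp Kr : ℝ} (hp : Measurable p)
    (hKp : 0 ≤ Kp) (hKr : 0 ≤ Kr) (hpl : LipJ Kp p) (h1 : ∫ y, p y ∂mu = 1)
    (hr : LipJ Kr (fun x => L p x - p x)) : |c - ∫ x, p x * ind I x ∂mu| ≤ 7 * Kr := by
  have hlim : Tendsto (fun n => |mass I n - ∫ x, p x * ind I x ∂mu|) atTop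
      (nhds |c - ∫ x, p x * ind I x ∂mu|) := (hc.sub_const _).abs
  have hlim2 : Tendsto (fun n : ℕ => (0.85 : ℝ) ^ n * (3 + Kp) + 7 * Kr) atTop (nhds (7 * Kr)) := by
    have := ((tendsto_pow_atTop_nhds_zero_of_lt_one (r := (0.85 : ℝ)) (by norm_num)
      (by norm_num)).mul_const (3 + Kp)).add_const (7 * Kr)
    simpa using this
  refine le_of_tendsto_of_tendsto' hlim hlim2 fun n => ?_
  rw [mass, ← integral_sub (intg (Lit_meas one_meas n) (one_bdd n) (ind_meas hI) (ind_abs I))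
    (intg hp (hpl.bdd hKp) (ind_meas hI) (ind_abs I))]
  have hb : ∀ x ∈ J, |L^[n] one x - p x| ≤ (0.85 : ℝ) ^ n * (3 + Kp) + 7 * Kr := by
    intro x hx
    have h0 := one_iter 0
    have a1 := diff_bdd (by norm_num) one_meas h0.1 hKp hp hpl (by rw [h1]; exact h0.2) n x hx
    have a2 := approx_bdd hp hKp hKr hpl hr n x hx
    have a3 : (∑ k ∈ Finset.range n, (0.85 : ℝ) ^ k) ≤ 7 := by
      rw [geom_sum_eq (by norm_num)]
      have : (0 : ℝ) ≤ (17 / 20) ^ n := by positivity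
      rw [div_le_iff_of_neg (by norm_num)]
      norm_num
      linarith
    have a4 : (∑ k ∈ Finset.range n, (0.85 : ℝ) ^ k) * Kr ≤ 7 * Kr :=
      mul_le_mul_of_nonneg_right a3 hKr
    have e : L^[n] one x - p x = (L^[n] one x - L^[n] p x) + (L^[n] p x - p x) := by ring
    rw [e]
    exact (abs_add_le _ _).trans (by linarith)
  have := int_bound hb (ind_abs I)
  simpa only [sub_mul] using this

/-- centred indicator -/
noncomputable def cen (I : Set ℝ) (c : ℝ) : ℝ → ℝ := fun x => ind I x - c

lemma cen_meas {I : Set ℝ} (hI : MeasurableSet I) (c : ℝ) : Measurable (cen I c) :=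
  (ind_meas hI).sub_const c

lemma cen_abs {I : Set ℝ} {c : ℝ} (hc0 : 0 ≤ c) (hc1 : c ≤ 1) (x : ℝ) : |cen I c x| ≤ 1 := by
  have := ind_01 I x
  unfold cen
  rw [abs_le]; constructor <;> linarith

lemma int_cen {I : Set ℝ} (hI : MeasurableSet I) (c : ℝ) (n : ℕ) :
    ∫ x, L^[n] one x * cen I c x ∂mu = mass I n - c := by
  have h1 := intg (Lit_meas one_meas n) (one_bdd n) (ind_meas hI) (ind_abs I)
  have h2 := integrable_of_bdd (Lit_meas one_meas n) (one_bdd n)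
  have e : (fun x => L^[n] one x * cen I c x) =
      fun x => L^[n] one x * ind I x - L^[n] one x * c := by
    ext x; simp only [cen]; ring
  rw [e, integral_sub h1 (h2.mul_const c), integral_mul_const, (one_iter n).2, mass]
  ring

lemma corr {I : Set ℝ} (hI : Good I) {c : ℝ} (hc0 : 0 ≤ c) (hc1 : c ≤ 1)
    (hc : ∀ n, |mass I n - c| ≤ 40 * 0.85 ^ n) (j m : ℕ) :
    |∫ x, cen I c (T^[j] x) * cen I c (T^[j + m + 1] x) ∂mu| ≤ 50 * 0.85 ^ m := by
  set g := cen I c with hg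
  have hgm : Measurable g := cen_meas hI.1 c
  have hga : ∀ x, |g x| ≤ 1 := cen_abs hc0 hc1
  set F : ℝ → ℝ := L (fun x => g x * L^[j] one x) with hF
  have hum : Measurable (fun x => g x * L^[j] one x) := hgm.mul (Lit_meas one_meas j)
  have hub : ∀ x ∈ J, |g x * L^[j] one x| ≤ 4 := by
    intro x hx
    rw [abs_mul]
    have := hga x
    have := one_bdd j x hx
    nlinarith [abs_nonneg (g x), abs_nonneg (L^[j] one x)]
  have hFm : Measurable F := L_meas hum
  have e1 : ∫ x, g (T^[j] x) * g (T^[j + m + 1] x) ∂mu = ∫ x, L^[m] F x * g x ∂mu := by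
    have h1 : ∫ x, one x * (fun z => g z * g (T^[m + 1] z)) (T^[j] x) ∂mu
        = ∫ x, L^[j] one x * (fun z => g z * g (T^[m + 1] z)) x ∂mu := by
      refine dual_iter (B := 1) (hgm.mul (hgm.comp (Tit_meas (m + 1)))) ?_ j one_meas (A := 1)
        (by simp [one])
      intro x
      change |g x * g (T^[m + 1] x)| ≤ 1
      rw [abs_mul]
      have := hga x
      have := hga (T^[m + 1] x)
      nlinarith [abs_nonneg (g x), abs_nonneg (g (T^[m + 1] x))]
    have h2 := dual_iter hgm hga (m + 1) hum hub
    rw [Function.iterate_succ_apply] at h2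
    rw [← h2]
    have e : ∀ x, T^[j + m + 1] x = T^[m + 1] (T^[j] x) := by
      intro x
      rw [← Function.iterate_add_apply, show j + m + 1 = m + 1 + j by ring]
    simp only [one, one_mul] at h1
    simp only [e]
    rw [h1]
    congr 1; ext x; ring
  rw [e1]
  have hFl : LipJ 5 F := by
    have a1 := hI.2 (L^[j] one) (one_iter j).1 (one_bdd j)
    have a2 := (one_iter (j + 1)).1.const_mul (-c)
    have a3 := a1.add a2
    have hcc : |(-c)| ≤ 1 := by rw [abs_neg, abs_of_nonneg hc0]; exact hc1
    refine (a3.mono (by linarith)).congr ?_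
    intro x _
    rw [Function.iterate_succ_apply', hF]
    have : (fun x => g x * L^[j] one x) =
        fun x => 1 * (ind I x * L^[j] one x) + (-c) * L^[j] one x := by
      ext x; simp only [hg, cen]; ring
    rw [this, L_lin]
    ring
  set M := ∫ x, F x ∂mu with hM
  have hMv : M = mass I j - c := by
    rw [hM, hF, mean_L hum hub, ← int_cen hI.1]
    congr 1; ext x; ring
  have hFi : Integrable F mu := integrable_of_bdd hFm (hFl.bdd (by norm_num))
  have hG0 : ∫ x, (F x - M) ∂mu = 0 := by
    rw [integral_sub hFi (integrable_const _)]; simp [hM]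
  have hGm : Measurable (fun x => F x - M) := hFm.sub_const M
  have hb := zero_bdd (by norm_num) hGm (hFl.sub_const M) hG0 m
  have hsplit : ∀ x, L^[m] F x = L^[m] (fun x => F x - M) x + M * L^[m] one x := by
    intro x
    have := congrFun (Lit_lin 1 M (fun x => F x - M) one m) x
    rw [one_mul] at this
    rw [← this]
    have e : F = fun x => 1 * (F x - M) + M * one x := by ext x; simp [one]
    rw [← e]
  have i1 := intg (Lit_meas hGm m) hb hgm hga
  have i2 := (intg (Lit_meas one_meas m) (one_bdd m) hgm hga).const_mul M
  have e2 : ∫ x, L^[m] F x * g x ∂mu =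
      (∫ x, L^[m] (fun x => F x - M) x * g x ∂mu) + M * (mass I m - c) := by
    rw [← int_cen hI.1, ← integral_const_mul, ← integral_add i1 i2]
    congr 1; ext x; rw [hsplit]; ring
  rw [e2]
  have b1 := int_bound hb hga
  have b2 : |M * (mass I m - c)| ≤ 1 * (40 * 0.85 ^ m) := by
    rw [abs_mul]
    have hm1 : |M| ≤ 1 := by
      have := mass_01 hI.1 j
      rw [hMv, abs_le]; constructor <;> linarith
    exact mul_le_mul hm1 (hc m) (abs_nonneg _) (by norm_num)
  have hp : (0 : ℝ) ≤ 0.85 ^ m := by positivity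
  refine (abs_add_le _ _).trans ?_
  linarith

/-- Birkhoff sums -/
noncomputable def S (g : ℝ → ℝ) (n : ℕ) (x : ℝ) : ℝ := ∑ k ∈ Finset.range n, g (T^[k] x)

lemma S_meas {g : ℝ → ℝ} (hg : Measurable g) (n : ℕ) : Measurable (S g n) := by
  unfold S
  exact Finset.measurable_sum _ fun k _ => hg.comp (Tit_meas k)

lemma S_bdd {g : ℝ → ℝ} (hg : ∀ x, |g x| ≤ 1) (n : ℕ) (x : ℝ) : |S g n x| ≤ n := by
  unfold S
  refine (Finset.abs_sum_le_sum_abs _ _).trans ?_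
  calc ∑ k ∈ Finset.range n, |g (T^[k] x)| ≤ ∑ k ∈ Finset.range n, (1 : ℝ) :=
        Finset.sum_le_sum fun k _ => hg _
    _ = n := by simp

lemma S_var {I : Set ℝ} (hI : Good I) {c : ℝ} (hc0 : 0 ≤ c) (hc1 : c ≤ 1)
    (hc : ∀ n, |mass I n - c| ≤ 40 * 0.85 ^ n) (n : ℕ) :
    ∫ x, (S (cen I c) n x) ^ 2 ∂mu ≤ 1000 * n := by
  set g := cen I c with hg
  have hgm : Measurable g := cen_meas hI.1 c
  have hga : ∀ x, |g x| ≤ 1 := cen_abs hc0 hc1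
  induction n with
  | zero => simp [S]
  | succ n ih =>
    have i1 : Integrable (fun x => S g n x ^ 2) mu := by
      apply integrable_of_bdd (A := (n : ℝ) ^ 2) ((S_meas hgm n).pow_const 2)
      intro x _
      rw [abs_pow]
      exact pow_le_pow_left₀ (abs_nonneg _) (S_bdd hga n x) 2
    have ik : ∀ k m : ℕ, Integrable (fun x => g (T^[k] x) * g (T^[m] x)) mu := by
      intro k m
      exact intg (A := 1) (hgm.comp (Tit_meas k)) (fun x _ => hga _) (hgm.comp (Tit_meas m))
        (fun x => hga _)
    have e : (fun x => S g (n + 1) x ^ 2) = fun x => (S g n x ^ 2 +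
        2 * ∑ k ∈ Finset.range n, g (T^[k] x) * g (T^[n] x)) + g (T^[n] x) * g (T^[n] x) := by
      ext x
      rw [← Finset.sum_mul]
      have : S g (n + 1) x = S g n x + g (T^[n] x) := by simp [S, Finset.sum_range_succ]
      rw [this]
      simp only [S]
      ring
    have i2 : Integrable (fun x => 2 * ∑ k ∈ Finset.range n, g (T^[k] x) * g (T^[n] x)) mu :=
      (integrable_finsetSum _ fun k _ => ik k n).const_mul 2
    have i12 : Integrable (fun x => S g n x ^ 2 +
        2 * ∑ k ∈ Finset.range n, g (T^[k] x) * g (T^[n] x)) mu := i1.add i2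
    rw [e, integral_add i12 (ik n n), integral_add i1 i2, integral_const_mul,
      integral_finsetSum _ fun k _ => ik k n]
    have b1 : ∫ x, g (T^[n] x) * g (T^[n] x) ∂mu ≤ 1 :=
      (le_abs_self _).trans (int_bound (fun x _ => hga _) (fun x => hga _))
    have b2 : ∑ k ∈ Finset.range n, ∫ x, g (T^[k] x) * g (T^[n] x) ∂mu ≤ 50 * 7 := by
      calc ∑ k ∈ Finset.range n, ∫ x, g (T^[k] x) * g (T^[n] x) ∂mu
          ≤ ∑ k ∈ Finset.range n, 50 * (0.85 : ℝ) ^ (n - 1 - k) := by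
            apply Finset.sum_le_sum
            intro k hk
            have hk' := Finset.mem_range.1 hk
            have := corr hI hc0 hc1 hc k (n - 1 - k)
            rw [show k + (n - 1 - k) + 1 = n by omega] at this
            exact (le_abs_self _).trans this
        _ = 50 * ∑ k ∈ Finset.range n, (0.85 : ℝ) ^ k := by
            rw [← Finset.mul_sum, Finset.sum_range_reflect (fun k => (0.85 : ℝ) ^ k) n]
        _ ≤ 50 * 7 := by
            apply mul_le_mul_of_nonneg_left _ (by norm_num)
            rw [geom_sum_eq (by norm_num)]
            have : (0 : ℝ) ≤ (17 / 20) ^ n := by positivity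
            rw [div_le_iff_of_neg (by norm_num)]
            norm_num
            linarith
    push_cast
    linarith

lemma ae_conv {I : Set ℝ} (hI : Good I) {c : ℝ} (hc0 : 0 ≤ c) (hc1 : c ≤ 1)
    (hc : ∀ n, |mass I n - c| ≤ 40 * 0.85 ^ n) :
    ∀ᵐ x ∂mu, Tendsto (fun m : ℕ => S (cen I c) ((m + 1) ^ 2) x / ((m + 1) ^ 2 : ℕ)) atTop
      (nhds 0) := by
  set g := cen I c with hg
  have hgm : Measurable g := cen_meas hI.1 c
  have hga : ∀ x, |g x| ≤ 1 := cen_abs hc0 hc1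
  set q : ℕ → ℝ → ℝ := fun m x => (S g ((m + 1) ^ 2) x / ((m + 1) ^ 2 : ℕ)) ^ 2 with hq
  have hqm : ∀ m, Measurable (q m) := fun m => ((S_meas hgm _).div_const _).pow_const 2
  have hq0 : ∀ m x, 0 ≤ q m x := fun m x => sq_nonneg _
  have hqi : ∀ m, ∫⁻ x, ENNReal.ofReal (q m x) ∂mu ≤
      ENNReal.ofReal (1000 * (1 / ((m : ℝ) + 1) ^ 2)) := by
    intro m
    have hi : Integrable (q m) mu := by
      apply integrable_of_bdd (A := 1) (hqm m)
      intro x _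
      have h := S_bdd hga ((m + 1) ^ 2) x
      have hp : (0 : ℝ) < ((m + 1) ^ 2 : ℕ) := by positivity
      rw [hq, abs_pow, abs_div, abs_of_pos hp]
      apply pow_le_one₀ (by positivity)
      rw [div_le_one hp]; exact h
    rw [← ofReal_integral_eq_lintegral_ofReal hi (ae_of_all _ (hq0 m))]
    apply ENNReal.ofReal_le_ofReal
    have hv := S_var hI hc0 hc1 hc ((m + 1) ^ 2)
    simp only [hq, div_pow]
    rw [integral_div]
    rw [div_le_iff₀ (by positivity)]
    refine hv.trans (le_of_eq ?_)
    push_cast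
    field_simp
  have hsum : Summable (fun m : ℕ => 1000 * (1 / ((m : ℝ) + 1) ^ 2)) := by
    apply Summable.mul_left
    have := (summable_nat_add_iff 1).2 (Real.summable_one_div_nat_pow.2 (show 1 < 2 by norm_num))
    simpa using this
  have hfin : ∫⁻ x, ∑' m, ENNReal.ofReal (q m x) ∂mu ≠ ⊤ := by
    rw [lintegral_tsum fun m => (hqm m).ennreal_ofReal.aemeasurable]
    refine ne_top_of_le_ne_top ?_ (ENNReal.tsum_le_tsum hqi)
    rw [← ENNReal.ofReal_tsum_of_nonneg (fun m => by positivity) hsum]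
    exact ENNReal.ofReal_ne_top
  have hae := ae_lt_top (Measurable.ennreal_tsum fun m => (hqm m).ennreal_ofReal) hfin
  filter_upwards [hae] with x hx
  have h1 := ENNReal.tendsto_atTop_zero_of_tsum_ne_top hx.ne
  have h2 : Tendsto (fun m => q m x) atTop (nhds 0) := by
    have := (ENNReal.tendsto_toReal ENNReal.zero_ne_top).comp h1
    simpa [Function.comp_def, ENNReal.toReal_ofReal (hq0 _ x)] using this
  have h3 := h2.sqrt
  simp only [hq, Real.sqrt_sq_eq_abs, Real.sqrt_zero] at h3
  exact (tendsto_zero_iff_abs_tendsto_zero _).2 h3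

theorem freq_conv {I : Set ℝ} (hI : Good I) : ∃ c : ℝ,
    Tendsto (mass I) atTop (nhds c) ∧
    ∀ᵐ x ∂mu, Tendsto (fun n => freq x I n) atTop (nhds c) := by
  obtain ⟨c, hc⟩ := mass_lim hI.1
  have hc0 : 0 ≤ c := ge_of_tendsto' hc fun n => (mass_01 hI.1 n).1
  have hc1 : c ≤ 1 := le_of_tendsto' hc fun n => (mass_01 hI.1 n).2
  refine ⟨c, hc, ?_⟩
  have hr : ∀ n, |mass I n - c| ≤ 40 * 0.85 ^ n := by
    intro n
    have := dist_le_of_le_geometric_of_tendsto (0.85 : ℝ) 6 (by norm_num) (mass_step hI.1) hc n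
    rw [Real.dist_eq] at this
    refine this.trans ?_
    have : (0 : ℝ) ≤ (17 / 20) ^ n := by positivity
    rw [div_le_iff₀ (by norm_num)]
    norm_num
    linarith
  filter_upwards [ae_conv hI hc0 hc1 hr] with x hx
  set u : ℕ → ℝ := fun n => S (ind I) n x with hu
  have hfu : (fun n => freq x I n) = fun n => u n / n := by
    ext n
    simp only [freq, hu, S, ind, Set.indicator]
  rw [hfu]
  have hSu : ∀ n, S (cen I c) n x = u n - n * c := by
    intro n; simp [hu, S, cen, Finset.sum_sub_distrib]
  have hmono : Monotone u := by
    apply monotone_nat_of_le_succ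
    intro n
    simp only [hu, S, Finset.sum_range_succ]
    linarith [(ind_01 I (T^[n] x)).1]
  apply tendsto_div_of_monotone_of_exists_subseq_tendsto_div u c hmono
  intro a ha
  refine ⟨fun m => (m + 1) ^ 2, ?_, ?_, ?_⟩
  · have : Tendsto (fun m : ℕ => (1 + 1 / ((m : ℝ) + 1)) ^ 2) atTop (nhds 1) := by
      have := ((tendsto_one_div_add_atTop_nhds_zero_nat (𝕜 := ℝ)).const_add 1).pow 2
      simpa using this
    filter_upwards [this.eventually_lt_const ha] with m hm
    have e : (((m + 1 + 1) ^ 2 : ℕ) : ℝ) = (1 + 1 / ((m : ℝ) + 1)) ^ 2 * ((m + 1) ^ 2 : ℕ) := by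
      push_cast; field_simp; try ring
    rw [e]
    exact mul_le_mul_of_nonneg_right hm.le (by positivity)
  · exact (tendsto_pow_atTop two_ne_zero).comp (tendsto_add_atTop_nat 1)
  · have := hx.add_const c
    rw [zero_add] at this
    refine this.congr fun m => ?_
    rw [hSu]
    have : (((m + 1) ^ 2 : ℕ) : ℝ) ≠ 0 := by positivity
    field_simp
    ring

lemma good_of {I : Set ℝ} (hI : MeasurableSet I) {i : ℝ} (hi1 : 1 ≤ i) (hi3 : i ≤ 3)
    (h : ∀ u : ℝ → ℝ, ∀ y ∈ J, L (fun x => ind I x * u x) y = op i u y) : Good I := by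
  refine ⟨hI, fun u hu hb => ?_⟩
  have := op_lip (s := 1) hi1 hi3 (by norm_num) (by linarith) (by norm_num) (by norm_num) hu hb
  exact (this.mono (by norm_num)).congr (h u)

lemma ind_self {I : Set ℝ} {x : ℝ} (h : x ∈ I) : ind I x = 1 := by simp [ind, h]
lemma ind_not {I : Set ℝ} {x : ℝ} (h : x ∉ I) : ind I x = 0 := by simp [ind, h]

lemma in1 {y : ℝ} (hy : y ∈ J) : √(y + 1) - 1 ∈ I1 := cell1 ▸ phi_cell le_rfl hy
lemma in2 {y : ℝ} (hy : y ∈ J) : √(y + 2) - 1 ∈ I2 := cell2 ▸ phi_cell (by norm_num) hy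
lemma in3 {y : ℝ} (hy : y ∈ J) : √(y + 3) - 1 ∈ I3 := cell3 ▸ phi_cell (by norm_num) hy
lemma not12 {x : ℝ} (h : x ∈ I1) (h' : x ∈ I2) : False := by
  have := h.2; have := h'.1; linarith
lemma not23 {x : ℝ} (h : x ∈ I2) (h' : x ∈ I3) : False := by
  have := h.2; have := h'.1; linarith
lemma not13 {x : ℝ} (h : x ∈ I1) (h' : x ∈ I3) : False := by
  have := h.2; have := h'.1; have := s2; have := s3; linarith

lemma good1 : Good I1 := by
  refine good_of measurableSet_Ico (i := 1) (by norm_num) (by norm_num) fun u y hy => ?_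
  simp only [L, op, ind_self (in1 hy), ind_not fun h => not12 h (in2 hy),
    ind_not fun h => not13 h (in3 hy)]
  ring
lemma good2 : Good I2 := by
  refine good_of measurableSet_Ico (i := 2) (by norm_num) (by norm_num) fun u y hy => ?_
  simp only [L, op, ind_self (in2 hy), ind_not fun h => not12 (in1 hy) h,
    ind_not fun h => not23 h (in3 hy)]
  ring
lemma good3 : Good I3 := by
  refine good_of measurableSet_Ico (i := 3) (by norm_num) (by norm_num) fun u y hy => ?_
  simp only [L, op, ind_self (in3 hy), ind_not fun h => not13 (in1 hy) h,
    ind_not fun h => not23 (in2 hy) h]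
  ring

/-- value of an integer polynomial given by its coefficient list -/
noncomputable def ev : List ℤ → ℝ → ℝ
  | [], _ => 0
  | a :: l, x => a + x * ev l x

/-- integer evaluation -/
def evZ : List ℤ → ℤ → ℤ
  | [], _ => 0
  | a :: l, x => a + x * evZ l x

/-- sum of polynomials -/
def addL : List ℤ → List ℤ → List ℤ
  | [], m => m
  | a :: l, [] => a :: l
  | a :: l, b :: m => (a + b) :: addL l m

/-- scalar multiple -/
def smulL (c : ℤ) : List ℤ → List ℤ
  | [] => []
  | a :: l => (c * a) :: smulL c l

/-- product with the quadratic `a + b u + c u ^ 2` -/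
def mulQ (a b c : ℤ) (l : List ℤ) : List ℤ :=
  addL (smulL a l) (0 :: addL (smulL b l) (0 :: smulL c l))

/-- homogenized Horner substitution -/
def hor (h a b c : ℤ) : List ℤ → List ℤ
  | [] => []
  | x :: l => addL [x * h ^ (l.length + 1)] (mulQ a b c (hor h a b c l))

/-- weighted coefficients -/
def dk (k : ℤ) : List ℤ → List ℤ
  | [] => []
  | a :: l => (k * a) :: dk (k + 1) l

/-- derivative -/
def der : List ℤ → List ℤ
  | [] => []
  | _ :: l => dk 1 l

/-- coefficient norm -/
def nrm : List ℤ → ℕ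
  | [] => 0
  | a :: l => a.natAbs + nrm l

/-- the residual polynomial -/
def resid (q p : List ℤ) (i C R : ℤ) : List ℤ :=
  addL (smulL ((128 ^ 2) ^ p.length) (hor 128 (2 * C - 3 * 128) (2 * R) 0 q))
    (smulL (-(128 ^ q.length)) (hor (128 ^ 2) (2 * C ^ 2 - (2 * i + 1) * 128 ^ 2)
      (4 * C * R) (2 * R ^ 2) p))

/-- integer value of the substitution -/
def horZ (h z : ℤ) : List ℤ → ℤ
  | [] => 0
  | x :: l => x * h ^ (l.length + 1) + z * horZ h z l

/-- a priori bound for the coefficients of the substitution -/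
def horN (h z : ℕ) : List ℤ → ℕ
  | [] => 0
  | x :: l => x.natAbs * h ^ (l.length + 1) + z * horN h z l

/-- geometric sum -/
def geo (X : ℕ) : ℕ → ℕ
  | 0 => 0
  | n + 1 => 1 + X * geo X n

/-- weighted sum of the digits, shifted by `H` -/
def loop (X H : ℕ) : ℕ → ℕ → ℕ → ℕ
  | 0, _, _ => 0
  | n + 1, k, Z => (k * k) * ((Z % X - H) + (H - Z % X)) + loop X H n (k + 1) (Z / X)

/-- value of the residual polynomial at `X` -/
def residZ (q p : List ℤ) (i C R X : ℤ) : ℤ :=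
  (128 ^ 2) ^ p.length * horZ 128 ((2 * C - 3 * 128) + (2 * R) * X) q +
    (-(128 ^ q.length)) * horZ (128 ^ 2) ((2 * C ^ 2 - (2 * i + 1) * 128 ^ 2) +
      (4 * C * R) * X + (2 * R ^ 2) * X ^ 2) p

/-- bound for the coefficients of the residual polynomial -/
def residN (q p : List ℤ) (i C R : ℤ) : ℕ :=
  (128 ^ 2) ^ p.length * horN 128 ((2 * C - 3 * 128).natAbs + (2 * R).natAbs) q +
    (128 ^ q.length) * horN (128 ^ 2) ((2 * C ^ 2 - (2 * i + 1) * 128 ^ 2).natAbs +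
      (4 * C * R).natAbs + (2 * R ^ 2).natAbs) p

/-- the kernel certificate for one branch -/
def cert (q p : List ℤ) (i C R : ℤ) (K n : ℕ) : Bool :=
  Nat.ble q.length n && Nat.ble p.length n && Nat.ble (residN q p i C R + 1) (2 ^ K) &&
  Nat.ble (loop (2 ^ (K + 1)) (2 ^ K) (2 * n) 0
      (residZ q p i C R (2 ^ (K + 1)) + 2 ^ K * geo (2 ^ (K + 1)) (2 * n)).toNat * 10 ^ 57)
    (2 ^ 216 * (128 ^ 2) ^ p.length * 128 ^ q.length)

/-- the certificate for the value of one frequency, `k` in units of `10 ^ (-50)` -/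
def certV (p : List ℤ) (k : ℤ) : Bool :=
  Nat.ble (((evZ p 1 - evZ p (-1)) * 10 ^ 54 - k * 10 ^ 4 * 2 ^ 216).natAbs)
    ((10 ^ 4 - 1) * 2 ^ 216)

/-- coefficients of the approximate cdf on branch 1, in units of `2 ^ (-216)` -/
def p1 : List ℤ := [
  0,
  23786847025369181604900400377259034151915298951484359999279060770,
  -3118876510155512172938059656315520818118496819763284358028108780,
  611705861584873072590900531773829587098912045592786840646650002,
  -140759072097356355189284119559986499445527339770597705624136561,
  35299218807305619658606863501090034593884486132706333156919112,
  -9341247508224433325994875654671105964126943810284271523493092,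
  2564604951180633790676909683548625432942265787378125414853900,
  -723187429195824664322808918813181279894194934997874988674632,
  208115189751205380830793167467007512629897801635851070377980,
  -60853289511616291530437504944234173833371657191908820650589,
  18023816104080749172061681857896116349340766761540507670276,
  -5395143969887350339839609693502490533895497743344571734099,
  1629314179181468560170141043393112491315008116353687364331,
  -495761238390294280673817013158568088851314579223948667106,
  151826698557163680754549537303861826053032086040075427383,
  -46758792562490987721307683268946757763190103659654854598,
  14471631274376945954197582092838512711389537636617095564,
  -4498444735267650924249306373784585537803617616800467932,
  1403751979228684527245329354900556382328247879656991808,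
  -439568099231856734535942819171412577023517184193053081,
  138076698144314664994101804738459877769887853434484381,
  -43495545551722400433867824566034851345457038943567740,
  13736887769136196051799748958566766241474722257650693,
  -4348649794822041922812378819463961489006928114123447,
  1379616368190801836386711835371927280032723473772673,
  -438556381710837097990935179580047000017072523244418,
  139665659364080570222624305154561601963530810182224,
  -44554557800771946813516551524238701572929069405390,
  14235751255572515484982261825209869760581825215813,
  -4555197856199977779942662097596726226210296587627,
  1459587839373593517546225246415955223855911453860,
  -468285795085024247437545863874987960584500180404,
  150423153027137289145317873060083248118473700161,
  -48373743082695451425549127770722783583496378974,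
  15572815156609400494227033971368475762046488858,
  -5018345794441524884950053650844918081472397284,
  1618698040251267470150444940464905890045027940,
  -522589452477081461605001651588688740092999464,
  168859100522661011293727520040580526982561191,
  -54605752828613992466989435197790569823194210,
  17671967408455597824954740885802338655781072,
  -5723316181356390702680934074630888322794717,
  1854862947210026282531630048115730239155888,
  -601538084724222624060728662574552658771825,
  195203935276504809639232948949621587957735,
  -63383459212839066411022968910135705477159,
  20592725095655424684129964057948534936464,
  -6694089831432558660786886611607194575505,
  2177203689565441606621881041641019858514,
  -708479017851717198948915775817345478697,
  230656919685970637901097278565548258672,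
  -75129279700573601364741752847984908672,
  24482026419091410176920210692566098738,
  -7981297536669974110560587240464761297,
  2603038879792733674855119976012701414,
  -849302137467449011588167855764343176,
  277211942251183597752420032709645165,
  -90515694453930520155199194095164067,
  29565992121308953943620667489185770,
  -9660782668550950919550151935545173,
  3157754697754820136662394486942728,
  -1032490050120681302918643474245154,
  337699320192444808453985529654681,
  -110485926124920187096770498974277,
  36158635955207923556219635420846,
  -11836994759921110942929900048952,
  3876068327775831349908135396987,
  -1269574905317375485111357597432,
  415947688160111172846285710399,
  -136310488616150668641616770059,
  44681407456458506215496645283,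
  -14649688686374117513130515532,
  4804310014349527674040656016,
  -1575911937943106244185077508,
  517045174655039670785066986,
  -169675091530504115226191178,
  55692702325571791330113275,
  -18283810884745169546661847,
  6003729339470293879033293,
  -1971783628715339142530848,
  647707712535487926341549,
  -212803375799408674233521,
  69928729349730738930757,
  -22983097373171151864972,
  7555017213499813699573,
  -2483902754949710908663,
  816778430028197126689,
  -268622780169882945235,
  88358584925585440935,
  -29068356296380781728,
  9564373699448534526,
  -3147425900701386737,
  1035895703975432615,
  -340986164257441478,
  112257767735614834,
  -36961851413812031,
  12171594997604755,
  -4008635413917328,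
  1320382557830757,
  -434966741674933,
  143305978447155,
  -47219731655244,
  15560826616699,
  -5128504955469,
  1690428920231,
  -557250089347,
  183717100626,
  -60575129735,
  19974853913,
  -6587437951,
  2172662811,
  -716655130,
  236411953,
  -77995445,
  25734097,
  -8491566,
  2802239,
  -924827,
  305248,
  -100759,
  33262,
  -10981,
  3626,
  -1197,
  395,
  -131,
  43,
  -14,
  5,
  -2,
  1,
  0,
  0,
  0,
  0,
  0,
  0,
  0]

/-- coefficients of the approximate cdf on branch 2, in units of `2 ^ (-216)` -/
def p2 : List ℤ := [
  0,
  15877117664927567796761873952247616489433198969856134041353483945,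
  -1264387558065477585872719944508709608470269621897152167959144138,
  149231830530836712794473685731969156699752018401749636794687128,
  -20614538314402706128397461509374689703210979261598009128990982,
  3100717997178246964022870203125037444998273419652899044275166,
  -491981330643616850737094234245271874967618703882468846531232,
  80974402800013637473442819151231084857949906198776363306299,
  -13687978081325598408516900170508396951780100134647737742185,
  2361296535105999215835401669342252251515439870733191121479,
  -413900509703495666882442058676799677554004840249476622448,
  73491205748978961565952270910267482430630558772222848973,
  -13188096619203334937785768172265569071734549224802037147,
  2387750162820726969403978587583145329901957023005414132,
  -435588201201752399073014811680732704157590718915627225,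
  79980722837607484611248731367592979565327651068934019,
  -14768882998792827025510701342827721096353487823049198,
  2740702476538270107405318593751488500610249358849440,
  -510833023410188318221523801860646305883777481020882,
  95585174384374869673604628430455596487717949608217,
  -17948188057253443137438550122252582754069160414907,
  3380797615938186448689478015605208584977929607338,
  -638641773406974873800837247734975157468145690346,
  120954906931624026351093573528649562196938053642,
  -22962569304174523751272048085719591905517043335,
  4368809316042770711033451054172940345585298283,
  -832868104392919713928935591822034936250316271,
  159071869795133799912497574100706151006102365,
  -30433742109216890466501212440274838343911060,
  5831888679679644168870793004141397101968630,
  -1119199492837010913076188540623763561125677,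
  215083658283049821558150900249165902961292,
  -41387603940969023906267441270091498448075,
  7973721128775182522027811847155141125946,
  -1537969718911558439286511026736678837802,
  296962358300667640315156825445833390463,
  -57397803345579103970885698844200581400,
  11104652432421226946209644209410957063,
  -2150344523490343527681696003623518022,
  416757877085537821512349821406770468,
  -80837556492462100833068071412978457,
  15692005534945496778640348542763546,
  -3048338951154118709455221922920920,
  592587334571974465273146141108926,
  -115274067806173092270156558029198,
  22438189795269578636920792014935,
  -4370273711492320699465285579720,
  851691984416713644277061962915,
  -166072910385358746723659229338,
  32400165869797475873186537049,
  -6324386085357379573394589799,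
  1235103328283416981784897420,
  -241320148065962565074287895,
  47171678378037552155378386,
  -9224844580100893100796198,
  1804761068029147166895513,
  -353229221996773241315067,
  69161352208228080675754,
  -13546724055426667306210,
  2654381716792949186524,
  -520289869268782689541,
  102017610232444050550,
  -20010034713002993140,
  3926077148589951390,
  -770555100987375636,
  151278863038606645,
  -29708346331927627,
  5835802068550910,
  -1146676268453045,
  225369841019255,
  -44305958340591,
  8712376537972,
  -1713626787710,
  337130479132,
  -66340562457,
  13057406897,
  -2570566199,
  506165132,
  -99688450,
  19637416,
  -3869087,
  762457,
  -150280,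
  29626,
  -5841,
  1152,
  -227,
  45,
  -9,
  2,
  0,
  0,
  0]

/-- coefficients of the approximate cdf on branch 3, in units of `2 ^ (-216)` -/
def p3 : List ℤ := [
  0,
  12130457479611403767015841210899035638348345319975302977218808480,
  -696319271672599606841388010121324386922749773052322708925858040,
  58876576084235934779088609438758899979856946091636761765975978,
  -5815755135336844907502511751136546963232955102693779090706520,
  625054446953296834377121182636020097784817378002977579515228,
  -70838657025807223338698995400924756818962361932237549418910,
  8326336104178298802736809939354649279272252801012506964048,
  -1005045494899002269867481987344291986263001543918917047899,
  123797836279992107157276107824952277607305991528852858411,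
  -15493941819111089517898625269555107316197044935724529841,
  1964259636670769778423148643755416227846311237667842213,
  -251675800558541768196684148477916522114728234112933013,
  32534553579683821666301064914273091656271236161031853,
  -4237708683273506211935802150820562965605012108155884,
  555575003696961099518962575952543415690690918268255,
  -73250625748038197777807612212685414407138138651862,
  9705907497609588763576328252899595214547409116707,
  -1291719409836509383047440610476524304176740982795,
  172583453836465370683526988082417587675548763681,
  -23139449658894917875853597250246415610689203322,
  3112287392292683558480355025711087018962321951,
  -419807451119952278512629401192878845228693703,
  56774415588708471148381494594072273703714579,
  -7696440863657165664846555221840858042561248,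
  1045626516165251763789634696174644794616067,
  -142343416758069246474817786863172129426093,
  19413581611409769967680247079029038932798,
  -2652296559282833467436357104143356238588,
  362938950033649320286101029343221782915,
  -49738482507825805852167573397236592298,
  6825838850706838181551049511521067501,
  -937962085313145530187872814878343808,
  129046164042700980995541188424975175,
  -17774748404784218231112041247266278,
  2450931412261451459452300612930061,
  -338299580236102572229894627960686,
  46740122782809513324850316201680,
  -6463589796732664724339640732322,
  894607427591208644823431740194,
  -123921540515366302495432860593,
  17179042167391747063480158347,
  -2383265712750317872047924563,
  330865946498368578696736220,
  -45964605237981349775388564,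
  6389598853051637186850387,
  -888770979643326138479645,
  123697457483693743821262,
  -17225644307537505716176,
  2400069434634111997940,
  -334577106277642779570,
  46664191398864511984,
  -6511453309577119006,
  909014513928622721,
  -126956486014046376,
  17738752029654943,
  -2479525718123036,
  346725039771659,
  -48502800460343,
  6787467073357,
  -950172713171,
  133059572862,
  -18639469833,
  2611921919,
  -366118432,
  51334997,
  -7199992,
  1010120,
  -141753,
  19898,
  -2794,
  392,
  -55,
  8,
  -1,
  0,
  0]

/-- coefficients of the global approximate cdf -/
def q0 : List ℤ := addL p1 (addL p2 p3)

set_option maxRecDepth 100000 in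
lemma cert1 : cert q0 p1 1 155 27 3400 139 = true := by decide +kernel
set_option maxRecDepth 100000 in
lemma cert2 : cert q0 p2 2 202 21 3000 139 = true := by decide +kernel
set_option maxRecDepth 100000 in
lemma cert3 : cert q0 p3 3 238 18 3000 139 = true := by decide +kernel
set_option maxRecDepth 100000 in
lemma certq : evZ q0 1 - evZ q0 (-1) = 2 ^ 216 := by decide +kernel
set_option maxRecDepth 100000 in
lemma certV1 : certV p1 46407962944716719166021454266242962642460872990983 = true := by
  decide +kernel
set_option maxRecDepth 100000 in
lemma certV2 : certV p2 30441904494046044774395954980142705829742520632111 = true := by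
  decide +kernel
set_option maxRecDepth 100000 in
lemma certV3 : certV p3 23150132561237236059582590753614331527796606376905 = true := by
  decide +kernel

lemma ev_cast (l : List ℤ) (x : ℤ) : ev l (x : ℝ) = (evZ l x : ℤ) := by
  induction l with
  | nil => simp [ev, evZ]
  | cons a l ih => simp only [ev, evZ, ih]; push_cast; ring

lemma ev_addL (l m : List ℤ) (x : ℝ) : ev (addL l m) x = ev l x + ev m x := by
  induction l generalizing m with
  | nil => simp [ev, addL]
  | cons a l ih =>
    cases m with
    | nil => simp [ev, addL]
    | cons b m => simp only [ev, addL, ih]; push_cast; ring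

lemma ev_smulL (c : ℤ) (l : List ℤ) (x : ℝ) : ev (smulL c l) x = c * ev l x := by
  induction l with
  | nil => simp [ev, smulL]
  | cons a l ih => simp only [ev, smulL, ih]; push_cast; ring

lemma ev_mulQ (a b c : ℤ) (l : List ℤ) (x : ℝ) :
    ev (mulQ a b c l) x = (a + b * x + c * x ^ 2) * ev l x := by
  simp only [mulQ, ev_addL, ev_smulL, ev]; push_cast; ring

lemma ev_hor {h : ℤ} (a b c : ℤ) (l : List ℤ) (x z : ℝ) (hz : h * z = a + b * x + c * x ^ 2) :
    ev (hor h a b c l) x = (h : ℝ) ^ l.length * ev l z := by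
  induction l with
  | nil => simp [ev, hor]
  | cons y l ih =>
    simp only [hor, ev_addL, ev_mulQ, ih, ev, List.length_cons, ← hz]
    push_cast
    ring

lemma evZ_addL (l m : List ℤ) (x : ℤ) : evZ (addL l m) x = evZ l x + evZ m x := by
  have := ev_addL l m x
  simp only [ev_cast] at this
  exact_mod_cast this

lemma evZ_smulL (c : ℤ) (l : List ℤ) (x : ℤ) : evZ (smulL c l) x = c * evZ l x := by
  have := ev_smulL c l x
  simp only [ev_cast] at this
  exact_mod_cast this

lemma evZ_mulQ (a b c : ℤ) (l : List ℤ) (x : ℤ) :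
    evZ (mulQ a b c l) x = (a + b * x + c * x ^ 2) * evZ l x := by
  simp only [mulQ, evZ_addL, evZ_smulL, evZ]; ring

lemma evZ_hor (h a b c : ℤ) (l : List ℤ) (x : ℤ) :
    evZ (hor h a b c l) x = horZ h (a + b * x + c * x ^ 2) l := by
  induction l with
  | nil => simp [evZ, hor, horZ]
  | cons y l ih => simp only [hor, evZ_addL, evZ_mulQ, ih, evZ, horZ]; ring

lemma nrm_addL (l m : List ℤ) : nrm (addL l m) ≤ nrm l + nrm m := by
  induction l generalizing m with
  | nil => simp [nrm, addL]
  | cons a l ih =>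
    cases m with
    | nil => simp [nrm, addL]
    | cons b m =>
      simp only [nrm, addL]
      have := ih m
      have := Int.natAbs_add_le a b
      omega

lemma nrm_smulL (c : ℤ) (l : List ℤ) : nrm (smulL c l) = c.natAbs * nrm l := by
  induction l with
  | nil => simp [nrm, smulL]
  | cons a l ih => simp only [nrm, smulL, ih, Int.natAbs_mul]; ring

lemma nrm_mulQ (a b c : ℤ) (l : List ℤ) :
    nrm (mulQ a b c l) ≤ (a.natAbs + b.natAbs + c.natAbs) * nrm l := by
  unfold mulQ
  refine (nrm_addL _ _).trans ?_
  have h2 := nrm_addL (smulL b l) (0 :: smulL c l)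
  simp only [nrm, nrm_smulL, Int.natAbs_zero, zero_add] at h2 ⊢
  nlinarith

lemma nrm_hor (h : ℕ) (a b c : ℤ) (l : List ℤ) :
    nrm (hor h a b c l) ≤ horN h (a.natAbs + b.natAbs + c.natAbs) l := by
  induction l with
  | nil => simp [nrm, hor]
  | cons y l ih =>
    simp only [hor, horN]
    refine (nrm_addL _ _).trans ?_
    have h1 := nrm_mulQ a b c (hor h a b c l)
    have h2 := Nat.mul_le_mul_left (a.natAbs + b.natAbs + c.natAbs) ih
    simp only [nrm, Int.natAbs_mul, Int.natAbs_pow, Int.natAbs_natCast] at h1 ⊢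
    omega

lemma nrm_resid (q p : List ℤ) (i C R : ℤ) : nrm (resid q p i C R) ≤ residN q p i C R := by
  unfold resid residN
  refine (nrm_addL _ _).trans ?_
  have h1 := nrm_hor 128 (2 * C - 3 * 128) (2 * R) 0 q
  have h2 := nrm_hor (128 ^ 2) (2 * C ^ 2 - (2 * i + 1) * 128 ^ 2) (4 * C * R) (2 * R ^ 2) p
  rw [nrm_smulL, nrm_smulL]
  simp only [Int.natAbs_zero, add_zero] at h1
  rw [Int.natAbs_neg, Int.natAbs_pow, Int.natAbs_pow, Int.natAbs_pow]
  push_cast at h1 h2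
  exact Nat.add_le_add (Nat.mul_le_mul_left _ h1) (Nat.mul_le_mul_left _ h2)

lemma evZ_resid (q p : List ℤ) (i C R X : ℤ) :
    evZ (resid q p i C R) X = residZ q p i C R X := by
  simp only [resid, residZ, evZ_addL, evZ_smulL, evZ_hor, zero_mul, add_zero]

lemma len_addL (l m : List ℤ) : (addL l m).length ≤ max l.length m.length := by
  induction l generalizing m with
  | nil => simp [addL]
  | cons a l ih =>
    cases m with
    | nil => simp [addL]
    | cons b m =>
      have := ih m
      simp only [addL, List.length_cons]
      omega

lemma len_smulL (c : ℤ) (l : List ℤ) : (smulL c l).length = l.length := by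
  induction l with
  | nil => simp [smulL]
  | cons a l ih => simp [smulL, ih]

lemma len_hor (h a b c : ℤ) (l : List ℤ) : (hor h a b c l).length ≤ 2 * l.length := by
  induction l with
  | nil => simp [hor]
  | cons y l ih =>
    simp only [hor, mulQ]
    have h1 := len_addL [y * h ^ (l.length + 1)] (addL (smulL a (hor h a b c l))
      (0 :: addL (smulL b (hor h a b c l)) (0 :: smulL c (hor h a b c l))))
    have h2 := len_addL (smulL a (hor h a b c l))
      (0 :: addL (smulL b (hor h a b c l)) (0 :: smulL c (hor h a b c l)))
    have h3 := len_addL (smulL b (hor h a b c l)) (0 :: smulL c (hor h a b c l))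
    simp only [len_smulL, List.length_cons, List.length_nil] at h1 h2 h3 ⊢
    omega

lemma len_resid (q p : List ℤ) (i C R : ℤ) {n : ℕ} (hq : q.length ≤ n) (hp : p.length ≤ n) :
    (resid q p i C R).length ≤ 2 * n := by
  unfold resid
  refine (len_addL _ _).trans ?_
  rw [len_smulL, len_smulL]
  have := len_hor 128 (2 * C - 3 * 128) (2 * R) 0 q
  have := len_hor (128 ^ 2) (2 * C ^ 2 - (2 * i + 1) * 128 ^ 2) (4 * C * R) (2 * R ^ 2) p
  omega

/-- weighted coefficient norm -/
def wn : ℕ → List ℤ → ℕ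
  | _, [] => 0
  | k, a :: l => (k * k) * a.natAbs + wn (k + 1) l

lemma loop_eq {X H : ℕ} (hX : X = 2 * H) (hH : 0 < H) (n : ℕ) : ∀ (l : List ℤ) (k Z : ℕ),
    l.length ≤ n → nrm l < H → (Z : ℤ) = evZ l X + H * geo X n → loop X H n k Z = wn k l := by
  induction n with
  | zero =>
    intro l k Z hl _ _
    have : l = [] := List.length_eq_zero_iff.1 (by omega)
    subst this
    simp [loop, wn]
  | succ n ih =>
    intro l k Z hl hn hZ
    have key : ∀ (a : ℤ) (m : List ℤ), m.length ≤ n → a.natAbs + nrm m < H →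
        (Z : ℤ) = a + X * evZ m X + H * geo X (n + 1) →
        loop X H (n + 1) k Z = (k * k) * a.natAbs + wn (k + 1) m := by
      intro a m hm hnm hZ'
      have e : (Z : ℤ) = (a + H) + X * (evZ m X + H * geo X n) := by
        rw [hZ']; simp only [geo]; push_cast; ring
      have hmod : (Z : ℤ) % X = a + H := by
        rw [e, Int.add_mul_emod_self_left]
        apply Int.emod_eq_of_lt <;> omega
      have hdiv : (Z : ℤ) / X = evZ m X + H * geo X n := by
        rw [e, Int.add_mul_ediv_left _ _ (by omega), Int.ediv_eq_zero_of_lt (by omega) (by omega)]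
        ring
      have h1 := ih m (k + 1) (Z / X) hm (by omega) (by rw [← hdiv]; push_cast; rfl)
      simp only [loop, h1]
      have h2 : ((Z % X : ℕ) : ℤ) = a + H := by push_cast; exact hmod
      congr 2
      omega
    cases l with
    | nil =>
      have := key 0 [] (by simp) (by simpa [nrm] using hH) (by simpa [evZ] using hZ)
      rw [this]; simp [wn]
    | cons a m =>
      exact key a m (by simpa using hl) (by simpa [nrm] using hn) (by simpa [evZ] using hZ)

lemma nrm_dk (k : ℕ) (l : List ℤ) : nrm (dk k l) ≤ wn k l := by
  induction l generalizing k with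
  | nil => simp [dk, nrm]
  | cons a l ih =>
    have := ih (k + 1)
    simp only [dk, nrm, wn, Int.natAbs_mul, Int.natAbs_natCast]
    push_cast at this
    have h : k * a.natAbs ≤ k * k * a.natAbs := by
      rw [mul_assoc]; rcases k with _ | k
      · simp
      · exact Nat.mul_le_mul_left _ (Nat.le_mul_of_pos_left _ (by omega))
    omega

lemma nrm_dk2 (k : ℕ) (l : List ℤ) : nrm (dk k (dk (k + 1) l)) ≤ wn (k + 1) l := by
  induction l generalizing k with
  | nil => simp [dk, nrm]
  | cons a l ih =>
    have := ih (k + 1)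
    simp only [dk, nrm, wn, Int.natAbs_mul, Int.natAbs_natCast]
    push_cast at this
    have h0 : ((k : ℤ) + 1).natAbs = k + 1 := by omega
    have h : k * (((k : ℤ) + 1).natAbs * a.natAbs) ≤ (k + 1) * (k + 1) * a.natAbs := by
      rw [h0, mul_assoc]
      exact Nat.mul_le_mul_right _ (by omega)
    omega

lemma nrm_der (l : List ℤ) : nrm (der l) ≤ wn 0 l := by
  cases l with
  | nil => simp [der, nrm]
  | cons a l =>
    simp only [der, wn, zero_add]
    have := nrm_dk 1 l
    push_cast at this
    omega

lemma nrm_der2 (l : List ℤ) : nrm (der (der l)) ≤ wn 0 l := by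
  rcases l with _ | ⟨a, _ | ⟨b, l⟩⟩
  · simp [der, nrm]
  · simp [der, dk, nrm]
  · simp only [der, dk, wn]
    have := nrm_dk2 1 l
    push_cast at this
    norm_num at this ⊢
    omega

lemma cert_spec {q p : List ℤ} {i C R : ℤ} {K n : ℕ} (h : cert q p i C R K n = true) :
    wn 0 (resid q p i C R) * 10 ^ 57 ≤ 2 ^ 216 * (128 ^ 2) ^ p.length * 128 ^ q.length := by
  simp only [cert, Bool.and_eq_true, Nat.ble_eq] at h
  obtain ⟨⟨⟨h1, h2⟩, h3⟩, h4⟩ := h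
  have hn := nrm_resid q p i C R
  have hl := len_resid q p i C R h1 h2
  set l := resid q p i C R with hl'
  have hb : ∀ (n : ℕ) (l : List ℤ) (H X : ℕ), nrm l < H → X = 2 * H → l.length ≤ n →
      0 ≤ evZ l X + H * geo X n := by
    intro n
    induction n with
    | zero =>
      intro l H X _ _ hl
      have : l = [] := List.length_eq_zero_iff.1 (by omega)
      subst this
      simp [evZ, geo]
    | succ n ih =>
      intro l H X hn hX hl
      cases l with
      | nil => simp only [evZ]; positivity
      | cons a m =>
        simp only [nrm] at hn
        have h := ih m H X (by omega) hX (by simpa using hl)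
        have h' : (0 : ℤ) ≤ X * (evZ m X + H * geo X n) := mul_nonneg (by omega) h
        simp only [evZ, geo]
        push_cast
        have h0 : 0 ≤ a + H := by omega
        nlinarith
  have hX : (2 : ℕ) ^ (K + 1) = 2 * 2 ^ K := by ring
  have hnn := hb (2 * n) l (2 ^ K) (2 ^ (K + 1)) (by omega) hX hl
  rw [hl', evZ_resid] at hnn
  have hZ := Int.toNat_of_nonneg hnn
  have := loop_eq hX (by positivity) (2 * n) l 0
    (residZ q p i C R ((2 ^ (K + 1) : ℕ) : ℤ) + ((2 ^ K : ℕ) : ℤ) * geo (2 ^ (K + 1)) (2 * n)).toNat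
    hl (by omega) (by rw [hZ, hl', evZ_resid])
  push_cast at this
  rw [this] at h4
  exact h4

lemma ev_dk (k : ℤ) (l : List ℤ) (x : ℝ) : ev (dk (k + 1) l) x = ev (dk k l) x + ev l x := by
  induction l generalizing k with
  | nil => simp [ev, dk]
  | cons a l ih => simp only [ev, dk, ih]; push_cast; ring

lemma ev_der_cons (a : ℤ) (l : List ℤ) (x : ℝ) :
    ev (der (a :: l)) x = ev l x + x * ev (der l) x := by
  cases l with
  | nil => simp [ev, der, dk]
  | cons b l =>
    simp only [der, dk, ev]
    rw [ev_dk]; push_cast; ring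

lemma ev_hasDeriv (l : List ℤ) (x : ℝ) : HasDerivAt (ev l) (ev (der l) x) x := by
  induction l with
  | nil =>
    have : ev [] = fun _ => (0 : ℝ) := by ext; simp [ev]
    rw [this]; simpa [der, ev] using hasDerivAt_const x (0 : ℝ)
  | cons a l ih =>
    have e : ev (a :: l) = fun x => (a : ℝ) + x * ev l x := by ext; simp [ev]
    rw [e, ev_der_cons]
    have := ((hasDerivAt_id x).mul ih).const_add (a : ℝ)
    simpa using this

lemma ev_cont (l : List ℤ) : Continuous (ev l) :=
  continuous_iff_continuousAt.2 fun x => (ev_hasDeriv l x).continuousAt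

lemma ev_abs (l : List ℤ) {x : ℝ} (hx : |x| ≤ 1) : |ev l x| ≤ nrm l := by
  induction l with
  | nil => simp [ev, nrm]
  | cons a l ih =>
    simp only [ev, nrm]
    refine (abs_add_le _ _).trans ?_
    rw [abs_mul]
    push_cast
    have : |x| * |ev l x| ≤ 1 * nrm l := mul_le_mul hx ih (abs_nonneg _) (by norm_num)
    rw [← Int.cast_natCast, Int.natCast_natAbs]
    push_cast
    linarith

lemma ev_lip (l : List ℤ) {x y : ℝ} (hx : |x| ≤ 1) (hy : |y| ≤ 1) :
    |ev l x - ev l y| ≤ nrm (der l) * |x - y| := by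
  have := (convex_Icc (-1 : ℝ) 1).norm_image_sub_le_of_norm_hasDerivWithin_le
    (f := ev l) (f' := ev (der l)) (C := nrm (der l))
    (fun z _ => (ev_hasDeriv l z).hasDerivWithinAt)
    (fun z hz => ev_abs _ (abs_le.2 hz)) (abs_le.1 hy) (abs_le.1 hx)
  simpa [Real.norm_eq_abs] using this

/-- defect of the functional equation on one branch -/
noncomputable def Dl (q p : List ℤ) (i : ℤ) (t : ℝ) : ℝ :=
  ev q (2 * t - 3) - ev p (2 * t ^ 2 - 2 * i - 1)

/-- derivative of the defect -/
noncomputable def Dd (q p : List ℤ) (i : ℤ) (t : ℝ) : ℝ :=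
  2 * ev (der q) (2 * t - 3) - 4 * t * ev (der p) (2 * t ^ 2 - 2 * i - 1)

lemma Dl_deriv (q p : List ℤ) (i : ℤ) (t : ℝ) : HasDerivAt (Dl q p i) (Dd q p i t) t := by
  have h1 : HasDerivAt (fun t : ℝ => 2 * t - 3) 2 t := by
    simpa using ((hasDerivAt_id t).const_mul 2).sub_const 3
  have h2 : HasDerivAt (fun t : ℝ => 2 * t ^ 2 - 2 * i - 1) (4 * t) t := by
    have := (((hasDerivAt_pow 2 t).const_mul 2).sub_const (2 * (i : ℝ))).sub_const 1
    exact this.congr_deriv (by push_cast; ring)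
  have := ((ev_hasDeriv q _).comp t h1).sub ((ev_hasDeriv p _).comp t h2)
  exact this.congr_deriv (by unfold Dd; ring)

lemma resid_ev (q p : List ℤ) (i C R : ℤ) (hR : (R : ℝ) ≠ 0) (t : ℝ) :
    ev (resid q p i C R) ((128 * t - C) / R) =
      (128 ^ 2) ^ p.length * 128 ^ q.length * Dl q p i t := by
  unfold resid Dl
  rw [ev_addL, ev_smulL, ev_smulL, ev_hor _ _ _ q _ (2 * t - 3), ev_hor _ _ _ p _ (2 * t ^ 2 - 2 * i - 1)]
  · push_cast; ring
  · push_cast; field_simp; ring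
  · push_cast; field_simp; ring

lemma resid_der (q p : List ℤ) (i C R : ℤ) (hR : (R : ℝ) ≠ 0) (t : ℝ) :
    128 / R * ev (der (resid q p i C R)) ((128 * t - C) / R) =
      (128 ^ 2) ^ p.length * 128 ^ q.length * Dd q p i t := by
  have h1 : HasDerivAt (fun t : ℝ => (128 * t - C) / R) (128 / R) t := by
    simpa using (((hasDerivAt_id t).const_mul 128).sub_const (C : ℝ)).div_const (R : ℝ)
  have h2 := (ev_hasDeriv (resid q p i C R) _).comp t h1
  have h3 := (Dl_deriv q p i t).const_mul ((128 ^ 2) ^ p.length * 128 ^ q.length : ℝ)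
  have e : ev (resid q p i C R) ∘ (fun t : ℝ => (128 * t - C) / R) =
      fun t => (128 ^ 2) ^ p.length * 128 ^ q.length * Dl q p i t := by
    ext t; exact resid_ev q p i C R hR t
  rw [e] at h2
  rw [← h2.unique h3]; ring

/-- the parameter range of a branch -/
def Rg (C R : ℤ) (t : ℝ) : Prop := C - R ≤ 128 * t ∧ 128 * t ≤ C + R

lemma Rg.abs {C R : ℤ} (hR : (16 : ℝ) ≤ R) {t : ℝ} (h : Rg C R t) : |(128 * t - C) / R| ≤ 1 := by
  rw [abs_div, abs_of_pos (show (0 : ℝ) < R by linarith), div_le_one (by linarith), abs_le]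
  constructor <;> linarith [h.1, h.2]

lemma branch {q p : List ℤ} {i C R : ℤ} (hR : (16 : ℝ) ≤ R)
    (hc : wn 0 (resid q p i C R) * 10 ^ 57 ≤ 2 ^ 216 * (128 ^ 2) ^ p.length * 128 ^ q.length)
    {t t' : ℝ} (h : Rg C R t) (h' : Rg C R t') :
    |Dl q p i t - Dl q p i t'| ≤ 2 * 1e-57 * 2 ^ 216 ∧ |Dd q p i t| ≤ 8 * 1e-57 * 2 ^ 216 ∧
    |Dd q p i t - Dd q p i t'| ≤ 64 * 1e-57 * 2 ^ 216 * |t - t'| := by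
  have hR0 : (R : ℝ) ≠ 0 := by linarith
  have a := h.abs hR
  have a' := h'.abs hR
  have e1 := resid_ev q p i C R hR0 t
  have e1' := resid_ev q p i C R hR0 t'
  have e2 := resid_der q p i C R hR0 t
  have e2' := resid_der q p i C R hR0 t'
  have n1 : (nrm (der (resid q p i C R)) : ℝ) ≤ wn 0 (resid q p i C R) := by
    exact_mod_cast nrm_der _
  have n2 : (nrm (der (der (resid q p i C R))) : ℝ) ≤ wn 0 (resid q p i C R) := by
    exact_mod_cast nrm_der2 _
  have hcr : (wn 0 (resid q p i C R) : ℝ) * 10 ^ 57 ≤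
      2 ^ 216 * (128 ^ 2) ^ p.length * 128 ^ q.length := by exact_mod_cast hc
  generalize (wn 0 (resid q p i C R) : ℝ) = W at *
  set E := resid q p i C R
  have hs : (0 : ℝ) < (128 ^ 2) ^ p.length * 128 ^ q.length := by positivity
  have hW : W ≤ 1e-57 * 2 ^ 216 * ((128 ^ 2) ^ p.length * 128 ^ q.length) := by
    norm_num at hcr ⊢
    linarith
  generalize ((128 : ℝ) ^ 2) ^ p.length * 128 ^ q.length = sc at *
  set u := (128 * t - C) / R with hu
  set u' := (128 * t' - C) / R with hu'
  have l1 := ev_lip E a a'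
  have l2 := ev_abs (der E) a
  have l3 := ev_lip (der E) a a'
  have huu : u - u' = 128 / R * (t - t') := by rw [hu, hu']; ring
  have h8 : 128 / (R : ℝ) ≤ 8 := by rw [div_le_iff₀ (by linarith)]; linarith
  have h80 : 0 < 128 / (R : ℝ) := by apply div_pos <;> linarith
  have hW0 : 0 ≤ W := le_trans (Nat.cast_nonneg _) n1
  have hu2 : |u - u'| ≤ 2 := by
    have := abs_sub u u'
    linarith
  refine ⟨?_, ?_, ?_⟩
  · refine le_of_mul_le_mul_left ?_ hs
    rw [← abs_of_pos hs, ← abs_mul, mul_sub, ← e1, ← e1', abs_of_pos hs]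
    calc _ ≤ _ := l1
      _ ≤ W * 2 := mul_le_mul n1 hu2 (abs_nonneg _) hW0
      _ ≤ _ := by linarith
  · refine le_of_mul_le_mul_left ?_ hs
    rw [← abs_of_pos hs, ← abs_mul, ← e2, abs_of_pos hs, abs_mul, abs_of_pos h80]
    calc _ ≤ 8 * W := mul_le_mul h8 (l2.trans n1) (abs_nonneg _) (by norm_num)
      _ ≤ _ := by linarith
  · refine le_of_mul_le_mul_left ?_ hs
    rw [← abs_of_pos hs, ← abs_mul, mul_sub, ← e2, ← e2', abs_of_pos hs, ← mul_sub, abs_mul,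
      abs_of_pos h80]
    have : |u - u'| ≤ 8 * |t - t'| := by
      rw [huu, abs_mul, abs_of_pos h80]
      exact mul_le_mul_of_nonneg_right h8 (abs_nonneg _)
    calc _ ≤ 8 * (W * (8 * |t - t'|)) :=
          mul_le_mul h8 (l3.trans (mul_le_mul n2 this (abs_nonneg _) hW0)) (abs_nonneg _)
            (by norm_num)
      _ = W * (64 * |t - t'|) := by ring
      _ ≤ _ := mul_le_mul_of_nonneg_right hW (by positivity)
      _ = _ := by ring

lemma op_lip' {i K A : ℝ} {f : ℝ → ℝ} (hi1 : 1 ≤ i)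
    (hK : 0 ≤ K) (hA : 0 ≤ A)
    (hf : ∀ y ∈ J, ∀ z ∈ J, |f (√(y + i) - 1) - f (√(z + i) - 1)| ≤ K * |√(y + i) - √(z + i)|)
    (hb : ∀ y ∈ J, |f (√(y + i) - 1)| ≤ A) :
    LipJ (K / 4 + A / 4) (op i f) := by
  intro y hy z hz
  have hd := sqrt_diff (i := i) (s := 1) one_pos (by simpa using hi1) hy hz
  have a1 : 1 ≤ √(y + i) := Real.le_sqrt_of_sq_le (by linarith [hy.1])
  have a2 : 1 ≤ √(z + i) := Real.le_sqrt_of_sq_le (by linarith [hz.1])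
  have h1 := hf y hy z hz
  have h2 := hb z hz
  unfold op
  set a := √(y + i)
  set b := √(z + i)
  have ha : 0 < a := by linarith
  have hb' : 0 < b := by linarith
  have e : f (a - 1) / (2 * a) - f (b - 1) / (2 * b)
      = (f (a - 1) - f (b - 1)) / (2 * a) + f (b - 1) * ((b - a) / (2 * a * b)) := by
    field_simp; ring
  rw [e]
  refine (abs_add_le _ _).trans ?_
  rw [abs_mul (f (b - 1)), abs_div, abs_div, abs_of_pos (show 0 < 2 * a by positivity),
    abs_of_pos (show 0 < 2 * a * b by positivity), abs_sub_comm b a]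
  have h1' : |f (a - 1) - f (b - 1)| ≤ K * (|y - z| / (2 * 1)) :=
    h1.trans (mul_le_mul_of_nonneg_left hd hK)
  have t1 : |f (a - 1) - f (b - 1)| / (2 * a) ≤ K * (|y - z| / (2 * 1)) / (2 * 1) := by
    gcongr
  have t2 : |f (b - 1)| * (|a - b| / (2 * a * b)) ≤ A * ((|y - z| / (2 * 1)) / (2 * 1 * 1)) := by
    gcongr
  refine (add_le_add t1 t2).trans (le_of_eq ?_)
  ring

lemma branch_lip {q p : List ℤ} {i C R : ℤ} (hR : (16 : ℝ) ≤ R) (hi : (1 : ℝ) ≤ i)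
    (hc : wn 0 (resid q p i C R) * 10 ^ 57 ≤ 2 ^ 216 * (128 ^ 2) ^ p.length * 128 ^ q.length)
    (hg : ∀ y ∈ J, Rg C R (√(y + i))) :
    LipJ (18 * 1e-57) (op i (fun x => Dd q p i (x + 1) / 2 ^ 216)) := by
  have h := op_lip' (i := i) (K := 64 * 1e-57) (A := 8 * 1e-57)
    (f := fun x => Dd q p i (x + 1) / 2 ^ 216) hi (by norm_num) (by norm_num) ?_ ?_
  · exact h.mono (by norm_num)
  · intro y hy z hz
    have := (branch hR hc (hg y hy) (hg z hz)).2.2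
    simp only [sub_add_cancel]
    rw [← sub_div, abs_div, abs_of_pos (show (0 : ℝ) < 2 ^ 216 by positivity),
      div_le_iff₀ (by positivity)]
    linarith
  · intro y hy
    have := (branch hR hc (hg y hy) (hg y hy)).2.1
    simp only [sub_add_cancel]
    rw [abs_div, abs_of_pos (show (0 : ℝ) < 2 ^ 216 by positivity), div_le_iff₀ (by positivity)]
    exact this

/-- the approximate invariant density -/
noncomputable def dens (q : List ℤ) (x : ℝ) : ℝ := 2 * ev (der q) (2 * x - 1) / 2 ^ 216

lemma dens_deriv (q : List ℤ) (x : ℝ) :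
    HasDerivAt (fun x => ev q (2 * x - 1) / 2 ^ 216) (dens q x) x := by
  have h1 : HasDerivAt (fun t : ℝ => 2 * t - 1) 2 x := by
    simpa using ((hasDerivAt_id x).const_mul 2).sub_const 1
  have := ((ev_hasDeriv q _).comp x h1).div_const (2 ^ 216)
  exact this.congr_deriv (by unfold dens; ring)

lemma dens_cont (q : List ℤ) : Continuous (dens q) := by
  unfold dens
  have := ev_cont (der q)
  fun_prop

lemma dens_lip (q : List ℤ) :
    LipJ (4 * nrm (der (der q)) / 2 ^ 216) (dens q) := by
  intro x hx y hy
  have := ev_lip (der q) (x := 2 * x - 1) (y := 2 * y - 1)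
    (abs_le.2 ⟨by linarith [hx.1], by linarith [hx.2]⟩)
    (abs_le.2 ⟨by linarith [hy.1], by linarith [hy.2]⟩)
  have e : 2 * x - 1 - (2 * y - 1) = 2 * (x - y) := by ring
  rw [e, abs_mul, abs_two] at this
  unfold dens
  rw [← sub_div, ← mul_sub, abs_div, abs_mul, abs_two,
    abs_of_pos (show (0 : ℝ) < 2 ^ 216 by positivity), div_mul_eq_mul_div]
  exact div_le_div_of_nonneg_right (by linarith) (by positivity)

lemma dens_int (q : List ℤ) {a b : ℝ} (hab : a ≤ b) :
    ∫ x in Set.Ico a b, dens q x = ev q (2 * b - 1) / 2 ^ 216 - ev q (2 * a - 1) / 2 ^ 216 := by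
  rw [integral_Ico_eq_integral_Ioc, ← intervalIntegral.integral_of_le hab]
  exact intervalIntegral.integral_eq_sub_of_hasDerivAt (fun x _ => dens_deriv q x)
    ((dens_cont q).intervalIntegrable _ _)

lemma der_add {q a b c : List ℤ} (h : ∀ x, ev q x = ev a x + ev b x + ev c x) (x : ℝ) :
    ev (der q) x = ev (der a) x + ev (der b) x + ev (der c) x := by
  have h1 := ((ev_hasDeriv a x).add (ev_hasDeriv b x)).add (ev_hasDeriv c x)
  have e : ev q = ev a + ev b + ev c := by ext x; simp [h x]
  rw [← e] at h1
  exact (ev_hasDeriv q x).unique h1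

lemma op_branch (q p : List ℤ) {i : ℤ} (hi : (1 : ℝ) ≤ i) {y : ℝ} (hy : y ∈ J) :
    op i (fun x => Dd q p i (x + 1) / 2 ^ 216) y =
      op i (dens q) y - 2 * ev (der p) (2 * y - 1) / 2 ^ 216 := by
  have hs : √(y + i) ^ 2 = y + i := Real.sq_sqrt (by linarith [hy.1])
  have h0 : 0 < √(y + i) := Real.sqrt_pos.2 (by linarith [hy.1])
  unfold op dens Dd
  have e1 : 2 * √(y + i) ^ 2 - 2 * (i : ℝ) - 1 = 2 * y - 1 := by rw [hs]; ring
  have e2 : 2 * (√(y + i) - 1) - 1 = 2 * √(y + i) - 3 := by ring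
  beta_reduce
  rw [sub_add_cancel, e1, e2]
  field_simp
  ring

lemma resid_lip {q a b c : List ℤ} (h : ∀ x, ev q x = ev a x + ev b x + ev c x) {K : ℝ}
    (h1 : LipJ K (op (1 : ℤ) (fun x => Dd q a 1 (x + 1) / 2 ^ 216)))
    (h2 : LipJ K (op (2 : ℤ) (fun x => Dd q b 2 (x + 1) / 2 ^ 216)))
    (h3 : LipJ K (op (3 : ℤ) (fun x => Dd q c 3 (x + 1) / 2 ^ 216))) :
    LipJ (3 * K) (fun x => L (dens q) x - dens q x) := by
  refine LipJ.congr (((h1.add h2).add h3).mono (by linarith)) ?_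
  intro y hy
  rw [op_branch q a (by norm_num) hy, op_branch q b (by norm_num) hy,
    op_branch q c (by norm_num) hy]
  unfold L
  have := der_add h (2 * y - 1)
  have e : dens q y = 2 * ev (der q) (2 * y - 1) / 2 ^ 216 := rfl
  rw [e, this]
  push_cast
  ring

lemma cell_val {q p : List ℤ} {i C R : ℤ} {I : Set ℝ} (hR : (16 : ℝ) ≤ R) (hi : (1 : ℝ) ≤ i)
    (hI : cell i = I) (hIm : MeasurableSet I) (hIJ : I ⊆ J)
    (hc : wn 0 (resid q p i C R) * 10 ^ 57 ≤ 2 ^ 216 * (128 ^ 2) ^ p.length * 128 ^ q.length)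
    (hg : Rg C R (√(i : ℝ))) (hg' : Rg C R (√((i : ℝ) + 1))) :
    |∫ x, dens q x * ind I x ∂mu - (ev p 1 - ev p (-1)) / 2 ^ 216| ≤ 2 * 1e-57 := by
  have e : (fun x => dens q x * ind I x) = I.indicator (dens q) := by
    ext x; by_cases hx : x ∈ I <;> simp [ind, hx]
  rw [e, integral_indicator hIm, mu, Measure.restrict_restrict hIm,
    Set.inter_eq_self_of_subset_left hIJ, ← hI, cell,
    dens_int q (by have := Real.sqrt_le_sqrt (show (i : ℝ) ≤ i + 1 by linarith); linarith)]
  have h := (branch hR hc hg' hg).1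
  unfold Dl at h
  rw [Real.sq_sqrt (by linarith), Real.sq_sqrt (by linarith)] at h
  have e1 : 2 * ((i : ℝ) + 1) - 2 * i - 1 = 1 := by ring
  have e2 : 2 * (i : ℝ) - 2 * i - 1 = -1 := by ring
  have e3 : ∀ s : ℝ, 2 * (s - 1) - 1 = 2 * s - 3 := by intro s; ring
  rw [e1, e2] at h
  rw [e3, e3, ← sub_div, ← sub_div, abs_div, abs_of_pos (show (0 : ℝ) < 2 ^ 216 by positivity),
    div_le_iff₀ (by positivity)]
  refine le_trans (le_of_eq ?_) h
  congr 1; ring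

lemma certV_spec {p : List ℤ} {k : ℤ} (h : certV p k = true) :
    |(ev p 1 - ev p (-1)) / 2 ^ 216 - k * 1e-50| ≤ 1e-50 - 1e-54 := by
  simp only [certV, Nat.ble_eq] at h
  have h1 : |(evZ p 1 - evZ p (-1)) * 10 ^ 54 - k * 10 ^ 4 * 2 ^ 216| ≤
      (((10 ^ 4 - 1) * 2 ^ 216 : ℕ) : ℤ) := by
    rw [Int.abs_eq_natAbs]; exact_mod_cast h
  have h2 : |((evZ p 1 : ℤ) - (evZ p (-1) : ℤ) : ℝ) * 10 ^ 54 - k * 10 ^ 4 * 2 ^ 216| ≤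
      (10 ^ 4 - 1) * 2 ^ 216 := by
    norm_num at h1 ⊢
    exact_mod_cast h1
  have c1 := ev_cast p 1
  have c2 := ev_cast p (-1)
  push_cast at c1 c2
  rw [← c1, ← c2] at h2
  have e : (ev p 1 - ev p (-1)) / 2 ^ 216 - k * 1e-50 =
      ((ev p 1 - ev p (-1)) * 10 ^ 54 - k * 10 ^ 4 * 2 ^ 216) / (10 ^ 54 * 2 ^ 216) := by
    field_simp
    norm_num
    ring
  rw [e, abs_div, abs_of_pos (show (0 : ℝ) < 10 ^ 54 * 2 ^ 216 by positivity),
    div_le_iff₀ (by positivity)]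
  refine h2.trans ?_
  norm_num

lemma r2 : (181 : ℝ) / 128 ≤ √2 ∧ √2 ≤ 182 / 128 :=
  ⟨Real.le_sqrt_of_sq_le (by norm_num), Real.sqrt_le_iff.2 (by norm_num)⟩
lemma r3 : (220 : ℝ) / 128 ≤ √3 ∧ √3 ≤ 223 / 128 :=
  ⟨Real.le_sqrt_of_sq_le (by norm_num), Real.sqrt_le_iff.2 (by norm_num)⟩

lemma Rg_mid {C R i : ℤ} (h : Rg C R √(i : ℝ)) (h' : Rg C R √((i : ℝ) + 1)) :
    ∀ y ∈ J, Rg C R (√(y + i)) := by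
  intro y hy
  have a := Real.sqrt_le_sqrt (show (i : ℝ) ≤ y + i by linarith [hy.1])
  have b := Real.sqrt_le_sqrt (show y + i ≤ (i : ℝ) + 1 by linarith [hy.2])
  exact ⟨by linarith [h.1], by linarith [h'.2]⟩

lemma g1 : Rg 155 27 √((1 : ℤ) : ℝ) ∧ Rg 155 27 √(((1 : ℤ) : ℝ) + 1) := by
  have := r2
  norm_num [Rg]
  linarith
lemma g2 : Rg 202 21 √((2 : ℤ) : ℝ) ∧ Rg 202 21 √(((2 : ℤ) : ℝ) + 1) := by
  have := r2
  have := r3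
  norm_num [Rg]
  refine ⟨⟨?_, ?_⟩, ?_, ?_⟩ <;> linarith
lemma g3 : Rg 238 18 √((3 : ℤ) : ℝ) ∧ Rg 238 18 √(((3 : ℤ) : ℝ) + 1) := by
  have := r3
  have := s4
  norm_num [Rg, s4]
  refine ⟨?_, ?_⟩ <;> linarith

lemma hq0 (x : ℝ) : ev q0 x = ev p1 x + ev p2 x + ev p3 x := by
  unfold q0
  rw [ev_addL, ev_addL, add_assoc]

lemma c1 : ∀ y ∈ J, Rg 155 27 (√(y + (1 : ℤ))) := Rg_mid g1.1 g1.2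
lemma c2 : ∀ y ∈ J, Rg 202 21 (√(y + (2 : ℤ))) := Rg_mid g2.1 g2.2
lemma c3 : ∀ y ∈ J, Rg 238 18 (√(y + (3 : ℤ))) := Rg_mid g3.1 g3.2

lemma final_lip : LipJ (3 * (18 * 1e-57)) (fun x => L (dens q0) x - dens q0 x) :=
  resid_lip hq0
    (branch_lip (by norm_num) (by norm_num) (cert_spec cert1) c1)
    (branch_lip (by norm_num) (by norm_num) (cert_spec cert2) c2)
    (branch_lip (by norm_num) (by norm_num) (cert_spec cert3) c3)

lemma dens_one : ∫ y, dens q0 y ∂mu = 1 := by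
  rw [mu, J, dens_int q0 (by norm_num)]
  have h := certq
  have c1 := ev_cast q0 1
  have c2 := ev_cast q0 (-1)
  push_cast at c1 c2
  norm_num only at c1 c2 ⊢
  rw [c1, c2, ← sub_div, ← Int.cast_sub, h]
  norm_num

lemma final_val {I : Set ℝ} {c : ℝ} {p : List ℤ} {i C R k : ℤ} (hI : cell i = I)
    (hIJ : I ⊆ J) (hIm : MeasurableSet I) (hc : Tendsto (mass I) atTop (nhds c))
    (hR : (16 : ℝ) ≤ R) (hi : (1 : ℝ) ≤ i)
    (hg : Rg C R √(i : ℝ) ∧ Rg C R √((i : ℝ) + 1)) {K n : ℕ}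
    (hct : cert q0 p i C R K n = true) (hv : certV p k = true) :
    |c - k * 1e-50| ≤ 1e-50 := by
  have a1 := mass_approx hIm hc (dens_cont q0).measurable (by positivity) (by norm_num)
    (dens_lip q0) dens_one final_lip
  have a2 := cell_val hR hi hI hIm hIJ (cert_spec hct) hg.1 hg.2
  have a3 := certV_spec hv
  generalize (∫ x, dens q0 x * ind I x ∂mu) = X at *
  generalize (ev p 1 - ev p (-1)) / 2 ^ 216 = Y at *
  have h1 := abs_sub_le c X (k * 1e-50)
  have h2 := abs_sub_le X Y (k * 1e-50)
  norm_num at *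
  linarith

lemma sub1 : I1 ⊆ J := by rw [J_union]; exact fun x hx => Or.inl (Or.inl hx)
lemma sub2 : I2 ⊆ J := by rw [J_union]; exact fun x hx => Or.inl (Or.inr hx)
lemma sub3 : I3 ⊆ J := by rw [J_union]; exact fun x hx => Or.inr hx

end BR

theorem digit_frequencies :
    ∀ᵐ x ∂(volume.restrict (Set.Ico (0 : ℝ) 1)),
      (∃ l : ℝ, Tendsto (fun n => freq x I1 n) atTop (nhds l) ∧
        |l - 0.46407962944716719166021454266242962642460872990983| ≤ 1e-50) ∧
      (∃ l : ℝ, Tendsto (fun n => freq x I2 n) atTop (nhds l) ∧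
        |l - 0.30441904494046044774395954980142705829742520632111| ≤ 1e-50) ∧
      (∃ l : ℝ, Tendsto (fun n => freq x I3 n) atTop (nhds l) ∧
        |l - 0.23150132561237236059582590753614331527796606376905| ≤ 1e-50) := by
  obtain ⟨a, ha, hA⟩ := BR.freq_conv BR.good1
  obtain ⟨b, hb, hB⟩ := BR.freq_conv BR.good2
  obtain ⟨c, hc, hC⟩ := BR.freq_conv BR.good3
  have va := BR.final_val (i := 1) (I := I1) (by simpa using BR.cell1) BR.sub1 measurableSet_Ico ha
    (by norm_num) (by norm_num) BR.g1 BR.cert1 BR.certV1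
  have vb := BR.final_val (i := 2) (I := I2) (by simpa using BR.cell2) BR.sub2 measurableSet_Ico hb
    (by norm_num) (by norm_num) BR.g2 BR.cert2 BR.certV2
  have vc := BR.final_val (i := 3) (I := I3) (by simpa using BR.cell3) BR.sub3 measurableSet_Ico hc
    (by norm_num) (by norm_num) BR.g3 BR.cert3 BR.certV3
  filter_upwards [hA, hB, hC] with x h1 h2 h3
  refine ⟨⟨a, h1, ?_⟩, ⟨b, h2, ?_⟩, ⟨c, h3, ?_⟩⟩
  · norm_num at va ⊢; exact va
  · norm_num at vb ⊢; exact vb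
  · norm_num at vc ⊢; exact vc
end

section
/- Let T be the Bolyai–Rényi map and let μ be a T-invariant Borel probability measure on [0,1) absolutely continuous with respect to Lebesgue measure. Then for Lebesgue-almost every x ∈ [0,1) and each i ∈ {1,2,3}, the limit lim_{n→∞} (1/n)·#{1 ≤ k ≤ n : T^{k−1}(x) ∈ I_i} exists and equals μ(I_i). -/
open MeasureTheory Real Filter

lemma T_meas : Measurable T := by
  unfold T
  refine Measurable.ite measurableSet_Iio (by fun_prop) ?_
  exact Measurable.ite measurableSet_Iio (by fun_prop) (by fun_prop)

/-- Inverse branches. -/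
noncomputable def psi (i y : ℝ) : ℝ := Real.sqrt (y + i) - 1

/-- Transfer operator. -/
noncomputable def P (g : ℝ → ℝ) (y : ℝ) : ℝ :=
  g (psi 1 y) / (2 * Real.sqrt (y + 1)) + g (psi 2 y) / (2 * Real.sqrt (y + 2))
    + g (psi 3 y) / (2 * Real.sqrt (y + 3))

structure Cone (L : ℝ) (g : ℝ → ℝ) : Prop where
  meas : Measurable g
  nonneg : ∀ x, 0 ≤ g x
  reg : ∀ y ∈ Set.Ico (0 : ℝ) 1, ∀ z ∈ Set.Ico (0 : ℝ) 1, g y ≤ Real.exp (L * |y - z|) * g z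

lemma psi_mem {i y : ℝ} (hi : 1 ≤ i) (hi3 : i ≤ 3) (hy : y ∈ Set.Ico (0 : ℝ) 1) :
    psi i y ∈ Set.Ico (0 : ℝ) 1 := by
  obtain ⟨h0, h1⟩ := hy
  unfold psi
  constructor
  · have : (1 : ℝ) ≤ Real.sqrt (y + i) := Real.le_sqrt_of_sq_le (by linarith)
    linarith
  · have : Real.sqrt (y + i) < 2 := by
      rw [Real.sqrt_lt' (by norm_num)]; linarith
    linarith

lemma psi_contr {i y z : ℝ} (hi : 1 ≤ i) (hy : 0 ≤ y) (hz : 0 ≤ z) :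
    |psi i y - psi i z| ≤ |y - z| / 2 := by
  unfold psi
  have a : (1 : ℝ) ≤ Real.sqrt (y + i) := Real.le_sqrt_of_sq_le (by linarith)
  have b : (1 : ℝ) ≤ Real.sqrt (z + i) := Real.le_sqrt_of_sq_le (by linarith)
  have a2 : Real.sqrt (y + i) ^ 2 = y + i := Real.sq_sqrt (by linarith)
  have b2 : Real.sqrt (z + i) ^ 2 = z + i := Real.sq_sqrt (by linarith)
  have e : y - z = (Real.sqrt (y + i) - 1 - (Real.sqrt (z + i) - 1)) *
      (Real.sqrt (y + i) + Real.sqrt (z + i)) := by nlinarith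
  rw [e, abs_mul, abs_of_nonneg (a := Real.sqrt (y + i) + Real.sqrt (z + i)) (by linarith)]
  have := abs_nonneg (Real.sqrt (y + i) - 1 - (Real.sqrt (z + i) - 1))
  nlinarith

lemma sqrt_dist {i y z : ℝ} (hi : 1 ≤ i) (hy : 0 ≤ y) (hz : 0 ≤ z) :
    Real.sqrt (z + i) ≤ Real.exp (|y - z| / 2) * Real.sqrt (y + i) := by
  apply Real.sqrt_le_iff.2
  refine ⟨by positivity, ?_⟩
  rw [mul_pow, Real.sq_sqrt (by linarith), ← Real.exp_nat_mul]
  have : ((2 : ℕ) : ℝ) * (|y - z| / 2) = |y - z| := by push_cast; ring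
  rw [this]
  have h1 := Real.add_one_le_exp |y - z|
  have h2 := neg_abs_le (y - z)
  have h3 := abs_nonneg (y - z)
  nlinarith

lemma term_cone {L : ℝ} (hL : 0 ≤ L) {g : ℝ → ℝ} (h : Cone L g) {i : ℝ} (hi : 1 ≤ i) (hi3 : i ≤ 3)
    {y z : ℝ} (hy : y ∈ Set.Ico (0 : ℝ) 1) (hz : z ∈ Set.Ico (0 : ℝ) 1) :
    g (psi i y) / (2 * Real.sqrt (y + i)) ≤
      Real.exp ((L / 2 + 1 / 2) * |y - z|) * (g (psi i z) / (2 * Real.sqrt (z + i))) := by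
  have h1 := h.reg _ (psi_mem hi hi3 hy) _ (psi_mem hi hi3 hz)
  have h2 : Real.exp (L * |psi i y - psi i z|) ≤ Real.exp (L / 2 * |y - z|) := by
    apply Real.exp_le_exp.2
    have := mul_le_mul_of_nonneg_left (psi_contr hi hy.1 hz.1) hL
    linarith
  have h3 := sqrt_dist hi hy.1 hz.1
  have py : 0 < Real.sqrt (y + i) := Real.sqrt_pos.2 (by linarith [hy.1])
  have pz : 0 < Real.sqrt (z + i) := Real.sqrt_pos.2 (by linarith [hz.1])
  have h4 : g (psi i y) ≤ Real.exp (L / 2 * |y - z|) * g (psi i z) :=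
    h1.trans (mul_le_mul_of_nonneg_right h2 (h.nonneg _))
  have e : Real.exp ((L / 2 + 1 / 2) * |y - z|) =
      Real.exp (L / 2 * |y - z|) * Real.exp (|y - z| / 2) := by
    rw [← Real.exp_add]; congr 1; ring
  rw [e, mul_div_assoc', div_le_div_iff₀ (by positivity) (by positivity)]
  have h5 := mul_le_mul h4 h3 pz.le (mul_nonneg (Real.exp_pos _).le (h.nonneg _))
  linarith

lemma P_cone {L : ℝ} (hL : 0 ≤ L) {g : ℝ → ℝ} (h : Cone L g) : Cone (L / 2 + 1 / 2) (P g) := by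
  have hg := h.meas
  refine ⟨?_, fun x => ?_, fun y hy z hz => ?_⟩
  · unfold P psi; fun_prop
  · unfold P
    have := h.nonneg (psi 1 x)
    have := h.nonneg (psi 2 x)
    have := h.nonneg (psi 3 x)
    positivity
  · unfold P
    have h1 := term_cone hL h (i := 1) (by norm_num) (by norm_num) hy hz
    have h2 := term_cone hL h (i := 2) (by norm_num) (by norm_num) hy hz
    have h3 := term_cone hL h (i := 3) (by norm_num) (by norm_num) hy hz
    linarith

lemma iter_cone {K : ℝ} (hK : 0 ≤ K) {g : ℝ → ℝ} (h : Cone (1 + K) g) (n : ℕ) :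
    Cone (1 + K / 2 ^ n) (P^[n] g) := by
  induction n with
  | zero => simpa using h
  | succ n ih =>
    rw [Function.iterate_succ_apply']
    convert P_cone (by positivity) ih using 1
    rw [pow_succ]; field_simp; ring

lemma T_psi {i y : ℝ} (hi : i = 1 ∨ i = 2 ∨ i = 3) (hy : y ∈ Set.Ico (0 : ℝ) 1) :
    T (psi i y) = y := by
  obtain ⟨h0, h1⟩ := hy
  have e : (psi i y) ^ 2 + 2 * psi i y = y + i - 1 := by
    unfold psi
    have := Real.sq_sqrt (show 0 ≤ y + i by rcases hi with h | h | h <;> linarith)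
    nlinarith
  have s23 : Real.sqrt 2 ≤ Real.sqrt 3 := Real.sqrt_le_sqrt (by norm_num)
  rcases hi with rfl | rfl | rfl
  · have : Real.sqrt (y + 1) < Real.sqrt 2 := Real.sqrt_lt_sqrt (by linarith) (by linarith)
    unfold T
    rw [if_pos (by unfold psi; linarith), e]; ring
  · have a : Real.sqrt (y + 2) < Real.sqrt 3 := Real.sqrt_lt_sqrt (by linarith) (by linarith)
    have b : Real.sqrt 2 ≤ Real.sqrt (y + 2) := Real.sqrt_le_sqrt (by linarith)
    unfold T
    rw [if_neg (by unfold psi; linarith), if_pos (by unfold psi; linarith), e]; ring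
  · have b : Real.sqrt 3 ≤ Real.sqrt (y + 3) := Real.sqrt_le_sqrt (by linarith)
    unfold T
    rw [if_neg (by unfold psi; linarith), if_neg (by unfold psi; linarith), e]; ring

lemma sqrt2_gt : (1 : ℝ) < Real.sqrt 2 := Real.lt_sqrt_of_sq_lt (by norm_num)
lemma sqrt3_lt : Real.sqrt 3 < 2 := by rw [Real.sqrt_lt' (by norm_num)]; norm_num
lemma sqrt23 : Real.sqrt 2 < Real.sqrt 3 := Real.sqrt_lt_sqrt (by norm_num) (by norm_num)

/-- each branch: image of an invariant set under psi -/
lemma image_psi (A : Set ℝ) (hA : T ⁻¹' A = A) {i : ℝ} (hi : i = 1 ∨ i = 2 ∨ i = 3) :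
    psi i '' (A ∩ Set.Ico 0 1) = A ∩ Set.Ico (Real.sqrt i - 1) (Real.sqrt (i + 1) - 1) := by
  have i1 : 1 ≤ i := by rcases hi with h | h | h <;> linarith
  have mem : ∀ y ∈ Set.Ico (0:ℝ) 1, (psi i y ∈ A ↔ y ∈ A) := by
    intro y hy
    rw [← hA, Set.mem_preimage, T_psi hi hy, hA]
  ext x
  constructor
  · rintro ⟨y, ⟨hyA, hy⟩, rfl⟩
    refine ⟨(mem y hy).2 hyA, ?_, ?_⟩
    · unfold psi
      have : Real.sqrt i ≤ Real.sqrt (y + i) := Real.sqrt_le_sqrt (by linarith [hy.1])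
      linarith
    · unfold psi
      have : Real.sqrt (y + i) < Real.sqrt (i + 1) :=
        Real.sqrt_lt_sqrt (by linarith [hy.1]) (by linarith [hy.2])
      linarith
  · rintro ⟨hxA, hx1, hx2⟩
    have s0 : 1 ≤ Real.sqrt i := Real.le_sqrt_of_sq_le (by linarith)
    have x0 : 0 ≤ x := by linarith
    have a1 : i ≤ (x + 1) ^ 2 := (Real.sqrt_le_left (by linarith)).1 (by linarith)
    have a2 : (x + 1) ^ 2 < i + 1 := (Real.lt_sqrt (by linarith)).1 (by linarith)
    have hy : (x + 1) ^ 2 - i ∈ Set.Ico (0:ℝ) 1 := ⟨by linarith, by linarith⟩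
    have e : psi i ((x + 1) ^ 2 - i) = x := by
      unfold psi
      rw [sub_add_cancel, Real.sqrt_sq (by linarith)]; ring
    refine ⟨(x + 1) ^ 2 - i, ⟨(mem _ hy).1 (by rwa [e]), hy⟩, e⟩

lemma branch_int (A : Set ℝ) (hAm : MeasurableSet A) (hA : T ⁻¹' A = A) {i : ℝ}
    (hi : i = 1 ∨ i = 2 ∨ i = 3) (g : ℝ → ℝ) :
    ∫⁻ x in A ∩ Set.Ico (Real.sqrt i - 1) (Real.sqrt (i + 1) - 1), ENNReal.ofReal (g x) =
      ∫⁻ y in A ∩ Set.Ico 0 1, ENNReal.ofReal (g (psi i y) / (2 * Real.sqrt (y + i))) := by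
  have i1 : 1 ≤ i := by rcases hi with h | h | h <;> linarith
  rw [← image_psi A hA hi]
  rw [lintegral_image_eq_lintegral_abs_deriv_mul (f' := fun y => 1 / (2 * Real.sqrt (y + i)))
    (hAm.inter measurableSet_Ico)]
  · apply setLIntegral_congr_fun (hAm.inter measurableSet_Ico)
    intro y hy
    simp only
    rw [← ENNReal.ofReal_mul (abs_nonneg _), abs_of_nonneg (by positivity)]
    congr 1; ring
  · intro y hy
    have h : HasDerivAt (fun y => y + i) 1 y := (hasDerivAt_id y).add_const i
    exact ((h.sqrt (by linarith [hy.2.1])).sub_const 1).hasDerivWithinAt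
  · intro y hy z hz h
    rw [← T_psi hi hy.2, ← T_psi hi hz.2, h]

lemma transfer (A : Set ℝ) (hAm : MeasurableSet A) (hA : T ⁻¹' A = A) {g : ℝ → ℝ}
    (hg : Measurable g) (h0 : ∀ x, 0 ≤ g x) :
    ∫⁻ x in A ∩ Set.Ico 0 1, ENNReal.ofReal (g x) =
      ∫⁻ y in A ∩ Set.Ico 0 1, ENNReal.ofReal (P g y) := by
  have b1 := branch_int A hAm hA (i := 1) (by simp) g
  have b2 := branch_int A hAm hA (i := 2) (by simp) g
  have b3 := branch_int A hAm hA (i := 3) (by simp) g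
  have e4 : Real.sqrt (3 + 1) = 2 := by
    rw [show (3 + 1 : ℝ) = 2 ^ 2 by norm_num, Real.sqrt_sq (by norm_num)]
  rw [show (1 + 1 : ℝ) = 2 by norm_num, Real.sqrt_one] at b1
  rw [show (2 + 1 : ℝ) = 3 by norm_num] at b2
  rw [e4] at b3
  have hs1 := sqrt2_gt
  have hs2 := sqrt3_lt
  have hs3 := sqrt23
  have hset : A ∩ Set.Ico 0 1 = (A ∩ Set.Ico (1 - 1) (Real.sqrt 2 - 1) ∪
      A ∩ Set.Ico (Real.sqrt 2 - 1) (Real.sqrt 3 - 1)) ∪ A ∩ Set.Ico (Real.sqrt 3 - 1) (2 - 1) := by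
    rw [← Set.inter_union_distrib_left, ← Set.inter_union_distrib_left,
      Set.Ico_union_Ico_eq_Ico (by linarith) (by linarith),
      Set.Ico_union_Ico_eq_Ico (by linarith) (by linarith)]
    norm_num
  have hP : ∀ y, ENNReal.ofReal (P g y) =
      ENNReal.ofReal (g (psi 1 y) / (2 * Real.sqrt (y + 1))) +
      ENNReal.ofReal (g (psi 2 y) / (2 * Real.sqrt (y + 2))) +
      ENNReal.ofReal (g (psi 3 y) / (2 * Real.sqrt (y + 3))) := by
    intro y
    have n : ∀ i : ℝ, 0 ≤ g (psi i y) / (2 * Real.sqrt (y + i)) := fun i =>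
      div_nonneg (h0 _) (by positivity)
    unfold P
    rw [ENNReal.ofReal_add (add_nonneg (n 1) (n 2)) (n 3), ENNReal.ofReal_add (n 1) (n 2)]
  have m : ∀ i : ℝ, Measurable fun y => ENNReal.ofReal (g (psi i y) / (2 * Real.sqrt (y + i))) := by
    intro i; unfold psi; fun_prop
  simp_rw [hP]
  rw [lintegral_add_right _ (m 3), lintegral_add_left (m 1), ← b1, ← b2, ← b3]
  conv_lhs => rw [hset]
  rw [lintegral_union (hAm.inter measurableSet_Ico), lintegral_union (hAm.inter measurableSet_Ico)]
  · rw [Set.disjoint_left]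
    rintro x ⟨_, hx⟩ ⟨_, hx'⟩
    linarith [hx.2, hx'.1]
  · rw [Set.disjoint_left]
    rintro x (⟨_, hx⟩ | ⟨_, hx⟩) ⟨_, hx'⟩ <;> linarith [hx.2, hx'.1]

lemma transfer_iter (A : Set ℝ) (hAm : MeasurableSet A) (hA : T ⁻¹' A = A) {K : ℝ} (hK : 0 ≤ K)
    {g : ℝ → ℝ} (h : Cone (1 + K) g) (n : ℕ) :
    ∫⁻ x in A ∩ Set.Ico 0 1, ENNReal.ofReal (g x) =
      ∫⁻ y in A ∩ Set.Ico 0 1, ENNReal.ofReal (P^[n] g y) := by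
  induction n with
  | zero => rfl
  | succ n ih =>
    rw [ih, Function.iterate_succ_apply']
    exact transfer A hAm hA (iter_cone hK h n).meas (iter_cone hK h n).nonneg

lemma key_ineq (A : Set ℝ) (hAm : MeasurableSet A) (hA : T ⁻¹' A = A) {K : ℝ} (hK : 0 ≤ K)
    {g : ℝ → ℝ} (h : Cone (1 + K) g) :
    volume (A ∩ Set.Ico 0 1) * ∫⁻ x in Set.Ico 0 1, ENNReal.ofReal (g x) ≤
      ENNReal.ofReal (Real.exp 2) * ∫⁻ x in A ∩ Set.Ico 0 1, ENNReal.ofReal (g x) := by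
  obtain ⟨n, hn⟩ := pow_unbounded_of_one_lt K (one_lt_two (α := ℝ))
  have hc := iter_cone hK h n
  have hKn : K / 2 ^ n ≤ 1 := by
    rw [div_le_one (by positivity)]; exact hn.le
  have hu := transfer_iter Set.univ MeasurableSet.univ rfl hK h n
  simp only [Set.univ_inter] at hu
  rw [hu, transfer_iter A hAm hA hK h n]
  set q := P^[n] g
  have hb : ∀ y ∈ Set.Ico (0:ℝ) 1, ∫⁻ x in Set.Ico 0 1, ENNReal.ofReal (q x) ≤
      ENNReal.ofReal (Real.exp 2) * ENNReal.ofReal (q y) := by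
    intro y hy
    calc ∫⁻ x in Set.Ico 0 1, ENNReal.ofReal (q x)
        ≤ ∫⁻ x in Set.Ico (0:ℝ) 1, ENNReal.ofReal (Real.exp 2) * ENNReal.ofReal (q y) := by
          apply setLIntegral_mono (by fun_prop)
          intro x hx
          rw [← ENNReal.ofReal_mul (Real.exp_pos _).le]
          apply ENNReal.ofReal_le_ofReal
          refine (hc.reg x hx y hy).trans (mul_le_mul_of_nonneg_right ?_ (hc.nonneg _))
          apply Real.exp_le_exp.2
          have : |x - y| ≤ 1 := by
            rw [abs_le]; constructor <;> linarith [hx.1, hx.2, hy.1, hy.2]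
          have h3 : 0 ≤ K / 2 ^ n := by positivity
          nlinarith [abs_nonneg (x - y)]
      _ = _ := by simp
  rw [mul_comm, ← setLIntegral_const, ← lintegral_const_mul _ hc.meas.ennreal_ofReal]
  apply setLIntegral_mono (by have := hc.meas; fun_prop)
  intro y hy
  exact hb y hy.2

lemma cone_exp (F : Set ℝ) {K : ℝ} (hK : 0 ≤ K) :
    Cone (1 + K) (fun x => Real.exp (-(K * Metric.infDist x F))) := by
  refine ⟨?_, fun x => (Real.exp_pos _).le, fun y _ z _ => ?_⟩
  · have := (Metric.continuous_infDist_pt F).measurable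
    fun_prop
  · rw [← Real.exp_add]
    apply Real.exp_le_exp.2
    have h1 : Metric.infDist z F ≤ Metric.infDist y F + dist z y := Metric.infDist_le_infDist_add_dist
    rw [dist_comm, Real.dist_eq] at h1
    nlinarith [abs_nonneg (y - z)]

lemma closed_null (A : Set ℝ) (hAm : MeasurableSet A) (hA : T ⁻¹' A = A)
    (hpos : volume (A ∩ Set.Ico 0 1) ≠ 0) (F : Set ℝ) (hF : IsClosed F)
    (hFJ : F ⊆ Set.Ico 0 1 \ A) : volume F = 0 := by
  rcases F.eq_empty_or_nonempty with rfl | hne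
  · simp
  have h1 : ∀ k : ℕ, volume (A ∩ Set.Ico 0 1) * volume F ≤ ENNReal.ofReal (Real.exp 2) *
      ∫⁻ x in A ∩ Set.Ico 0 1, ENNReal.ofReal (Real.exp (-((k : ℝ) * Metric.infDist x F))) := by
    intro k
    refine le_trans ?_ (key_ineq A hAm hA (Nat.cast_nonneg k) (cone_exp F (Nat.cast_nonneg k)))
    gcongr
    calc volume F = ∫⁻ x in F, 1 := by simp
      _ ≤ ∫⁻ x in F, ENNReal.ofReal (Real.exp (-((k : ℝ) * Metric.infDist x F))) := by
        apply setLIntegral_mono' hF.measurableSet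
        intro x hx
        rw [Metric.infDist_zero_of_mem hx]; simp
      _ ≤ _ := lintegral_mono_set (fun x hx => (hFJ hx).1)
  have h2 : Tendsto (fun k : ℕ => ∫⁻ x in A ∩ Set.Ico 0 1,
      ENNReal.ofReal (Real.exp (-((k : ℝ) * Metric.infDist x F)))) atTop
      (nhds (∫⁻ x in A ∩ Set.Ico (0:ℝ) 1, 0)) := by
    apply tendsto_lintegral_of_dominated_convergence (fun _ => 1)
    · intro k
      have := (cone_exp F (Nat.cast_nonneg k)).meas
      exact this.ennreal_ofReal
    · intro k
      refine Eventually.of_forall fun x => ?_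
      rw [ENNReal.ofReal_le_one]
      apply Real.exp_le_one_iff.2
      have : 0 ≤ Metric.infDist x F := Metric.infDist_nonneg
      have : 0 ≤ (k : ℝ) * Metric.infDist x F := by positivity
      linarith
    · simp only [lintegral_const, MeasurableSet.univ, Measure.restrict_apply, Set.univ_inter, one_mul]
      refine ((measure_mono Set.inter_subset_right).trans_lt ?_).ne
      simp
    · refine (ae_restrict_iff' (hAm.inter measurableSet_Ico)).2 (Eventually.of_forall fun x hx => ?_)
      have hd : 0 < Metric.infDist x F :=
        (hF.notMem_iff_infDist_pos hne).1 (fun hxF => (hFJ hxF).2 hx.1)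
      rw [← ENNReal.ofReal_zero]
      apply ENNReal.tendsto_ofReal
      apply Real.tendsto_exp_atBot.comp
      apply tendsto_neg_atTop_atBot.comp
      exact tendsto_natCast_atTop_atTop.atTop_mul_const hd
  have h3 := ge_of_tendsto' (ENNReal.Tendsto.const_mul h2 (Or.inr ENNReal.ofReal_ne_top)) h1
  simp only [lintegral_zero, mul_zero, nonpos_iff_eq_zero, mul_eq_zero] at h3
  exact h3.resolve_left hpos

lemma leb_ergodic (A : Set ℝ) (hAm : MeasurableSet A) (hA : T ⁻¹' A = A)
    (hpos : volume (A ∩ Set.Ico 0 1) ≠ 0) : volume (Set.Ico 0 1 \ A) = 0 := by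
  rw [(measurableSet_Ico.diff hAm).measure_eq_iSup_isClosed_of_ne_top]
  · simp only [ENNReal.iSup_eq_zero]
    intro F hFJ hF
    exact closed_null A hAm hA hpos F hF hFJ
  · exact ((measure_mono Set.diff_subset).trans_lt (by simp)).ne

noncomputable def G (f : ℝ → ℝ) : ℕ → ℝ → ℝ
  | 0 => f
  | n + 1 => fun x => f x + max 0 (G f n (T x))

lemma G_meas {f : ℝ → ℝ} (hf : Measurable f) (n : ℕ) : Measurable (G f n) := by
  have := T_meas
  induction n with
  | zero => exact hf
  | succ n ih => unfold G; fun_prop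

lemma G_bound {f : ℝ → ℝ} {C : ℝ} (hC : ∀ x, |f x| ≤ C) (n : ℕ) (x : ℝ) :
    |G f n x| ≤ (n + 1) * C := by
  have hC0 : 0 ≤ C := (abs_nonneg _).trans (hC 0)
  induction n generalizing x with
  | zero => simpa [G] using hC x
  | succ n ih =>
    have h1 := abs_le.1 (hC x)
    have h2 := abs_le.1 (ih (T x))
    have h3 : max 0 (G f n (T x)) ≤ (n + 1) * C := max_le (by positivity) h2.2
    have h4 : 0 ≤ max 0 (G f n (T x)) := le_max_left _ _
    have h5 : 0 ≤ (n + 1) * C := by positivity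
    simp only [G]
    push_cast
    rw [abs_le]
    constructor <;> linarith

lemma G_lower (f : ℝ → ℝ) (n : ℕ) (x : ℝ) : f x ≤ G f n x := by
  cases n with
  | zero => exact le_rfl
  | succ n => simp [G]

lemma G_mono (f : ℝ → ℝ) (n : ℕ) (x : ℝ) : G f n x ≤ G f (n + 1) x := by
  induction n generalizing x with
  | zero => exact G_lower f 1 x
  | succ n ih =>
    have := max_le_max (le_refl (0:ℝ)) (ih (T x))
    have e1 : G f (n + 1) x = f x + max 0 (G f n (T x)) := rfl
    have e2 : G f (n + 1 + 1) x = f x + max 0 (G f (n + 1) (T x)) := rfl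
    linarith

lemma S_le_G (f : ℝ → ℝ) (n : ℕ) (x : ℝ) : birkhoffSum T f (n + 1) x ≤ G f n x := by
  induction n generalizing x with
  | zero => simp [G]
  | succ n ih =>
    rw [birkhoffSum_succ']
    have := ih (T x)
    have h2 := le_max_right 0 (G f n (T x))
    have e1 : G f (n + 1) x = f x + max 0 (G f n (T x)) := rfl
    linarith

lemma unbdd_inv (f : ℝ → ℝ) :
    T ⁻¹' {x | ¬ BddAbove (Set.range fun n => birkhoffSum T f n x)} =
      {x | ¬ BddAbove (Set.range fun n => birkhoffSum T f n x)} := by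
  ext x
  simp only [Set.mem_preimage, Set.mem_setOf_eq, not_iff_not]
  constructor
  · rintro ⟨M, hM⟩
    refine ⟨max 0 (f x + M), ?_⟩
    rintro _ ⟨n, rfl⟩
    cases n with
    | zero => simp
    | succ n =>
      have := hM ⟨n, rfl⟩
      simp only at this ⊢
      rw [birkhoffSum_succ']
      exact le_max_of_le_right (by linarith)
  · rintro ⟨M, hM⟩
    refine ⟨M - f x, ?_⟩
    rintro _ ⟨n, rfl⟩
    have := hM ⟨n + 1, rfl⟩
    simp only at this ⊢
    rw [birkhoffSum_succ'] at this
    linarith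

lemma birk_meas {f : ℝ → ℝ} (hf : Measurable f) (n : ℕ) :
    Measurable (fun x => birkhoffSum T f n x) := by
  unfold birkhoffSum
  exact Finset.measurable_sum _ fun k _ => hf.comp (T_meas.iterate k)

lemma maximal (μ : Measure ℝ) [IsProbabilityMeasure μ] (hT : MeasurePreserving T μ μ)
    {f : ℝ → ℝ} (hf : Measurable f) {C : ℝ} (hC : ∀ x, |f x| ≤ C)
    (hA : ∀ᵐ x ∂μ, ¬ BddAbove (Set.range fun n => birkhoffSum T f n x)) : 0 ≤ ∫ x, f x ∂μ := by
  have hint : ∀ n, Integrable (G f n) μ := fun n =>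
    Integrable.of_bound (G_meas hf n).aestronglyMeasurable ((n + 1) * C)
      (Eventually.of_forall fun x => G_bound hC n x)
  have hlim : Tendsto (fun n => ∫ x, (G f (n + 1) x - G f n (T x)) ∂μ) atTop
      (nhds (∫ x, f x ∂μ)) := by
    apply tendsto_integral_of_dominated_convergence (fun _ => 2 * C)
    · intro n
      have h1 := G_meas hf (n + 1)
      have h2 := (G_meas hf n).comp T_meas
      exact (h1.sub h2).aestronglyMeasurable
    · exact integrable_const _
    · intro n
      refine Eventually.of_forall fun x => ?_
      have e1 : G f (n + 1) x = f x + max 0 (G f n (T x)) := rfl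
      have h1 := abs_le.1 (hC x)
      have h2 := abs_le.1 (hC (T x))
      have h3 := G_lower f n (T x)
      rw [Real.norm_eq_abs, e1, abs_le]
      rcases max_cases 0 (G f n (T x)) with h | h <;> constructor <;> linarith
    · filter_upwards [hA] with x hx
      have hTx : x ∈ T ⁻¹' {x | ¬ BddAbove (Set.range fun n => birkhoffSum T f n x)} := by
        rw [unbdd_inv]; exact hx
      have hex : ∃ n, 0 ≤ G f n (T x) := by
        by_contra! hcon
        apply hTx
        refine ⟨0, ?_⟩
        rintro _ ⟨n, rfl⟩
        cases n with
        | zero => simp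
        | succ n => exact (S_le_G f n (T x)).trans (hcon n).le
      obtain ⟨n0, hn0⟩ := hex
      apply tendsto_const_nhds.congr'
      filter_upwards [eventually_ge_atTop n0] with n hn
      have hm : G f n0 (T x) ≤ G f n (T x) :=
        monotone_nat_of_le_succ (f := fun n => G f n (T x)) (fun n => G_mono f n (T x)) hn
      have e1 : G f (n + 1) x = f x + max 0 (G f n (T x)) := rfl
      rw [e1, max_eq_right (by linarith)]; ring
  refine ge_of_tendsto' hlim fun n => ?_
  have hc : Integrable (fun x => G f n (T x)) μ := hT.integrable_comp_of_integrable (hint n)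
  rw [integral_sub (hint (n + 1)) hc]
  have : ∫ x, G f n (T x) ∂μ = ∫ x, G f n x ∂μ := by
    rw [← integral_map (f := G f n) T_meas.aemeasurable (G_meas hf n).aestronglyMeasurable, hT.map_eq]
  rw [this]
  have := integral_mono (hint n) (hint (n + 1)) (G_mono f n)
  linarith

lemma bdd_ae (μ : Measure ℝ) [IsProbabilityMeasure μ] (hT : MeasurePreserving T μ μ)
    (hsupp : μ (Set.Ico (0 : ℝ) 1)ᶜ = 0) (hac : μ ≪ volume)
    {f : ℝ → ℝ} (hf : Measurable f) {C : ℝ} (hC : ∀ x, |f x| ≤ C) (hneg : ∫ x, f x ∂μ < 0) :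
    ∀ᵐ x ∂(volume.restrict (Set.Ico (0 : ℝ) 1)),
      BddAbove (Set.range fun n => birkhoffSum T f n x) := by
  set A := {x | ¬ BddAbove (Set.range fun n => birkhoffSum T f n x)} with hAdef
  have hAm : MeasurableSet A := (measurableSet_bddAbove_range (birk_meas hf)).compl
  rw [ae_iff]
  change volume.restrict _ A = 0
  rw [Measure.restrict_apply hAm]
  by_contra hpos
  have h1 := hac (leb_ergodic A hAm (unbdd_inv f) hpos)
  have h2 : μ Aᶜ = 0 := by
    refine measure_mono_null (t := (Set.Ico 0 1 \ A) ∪ (Set.Ico 0 1)ᶜ) ?_ (measure_union_null h1 hsupp)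
    intro x hx
    by_cases h : x ∈ Set.Ico (0:ℝ) 1
    · exact Or.inl ⟨h, hx⟩
    · exact Or.inr h
  have := maximal μ hT hf hC (mem_ae_iff.2 h2)
  exact absurd hneg (not_lt.2 this)

lemma freq_eq (S : Set ℝ) (x : ℝ) (n : ℕ) :
    freq x S n = birkhoffSum T (S.indicator fun _ => (1:ℝ)) n x / n := by
  unfold freq birkhoffSum
  congr 1

lemma birk_affine (f : ℝ → ℝ) (a b : ℝ) (n : ℕ) (x : ℝ) :
    birkhoffSum T (fun x => a * f x + b) n x = a * birkhoffSum T f n x + n * b := by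
  simp [birkhoffSum, Finset.sum_add_distrib, Finset.mul_sum]

lemma freq_tendsto (μ : Measure ℝ) [IsProbabilityMeasure μ] (hT : MeasurePreserving T μ μ)
    (hsupp : μ (Set.Ico (0 : ℝ) 1)ᶜ = 0) (hac : μ ≪ volume) (S : Set ℝ) (hS : MeasurableSet S) :
    ∀ᵐ x ∂(volume.restrict (Set.Ico (0 : ℝ) 1)),
      Tendsto (fun n => freq x S n) atTop (nhds (μ S).toReal) := by
  set c := (μ S).toReal with hc
  set f : ℝ → ℝ := S.indicator fun _ => (1:ℝ) with hfdef
  have hf : Measurable f := measurable_const.indicator hS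
  have hf1 : ∀ x, |f x| ≤ 1 := by
    intro x
    by_cases hx : x ∈ S <;> simp [hfdef, hx]
  have hfi : Integrable f μ := Integrable.of_bound hf.aestronglyMeasurable 1 (Eventually.of_forall hf1)
  have hfint : ∫ x, f x ∂μ = c := by
    rw [hfdef, integral_indicator_const _ hS]; simp [hc, Measure.real]
  have key : ∀ a b : ℝ, a * c + b < 0 → ∀ᵐ x ∂(volume.restrict (Set.Ico (0 : ℝ) 1)),
      BddAbove (Set.range fun n => birkhoffSum T (fun x => a * f x + b) n x) := by
    intro a b hab
    refine bdd_ae μ hT hsupp hac (C := |a| + |b|) (by fun_prop) (fun x => ?_) ?_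
    · refine (abs_add_le _ _).trans ?_
      rw [abs_mul]
      have := mul_le_mul_of_nonneg_left (hf1 x) (abs_nonneg a)
      linarith
    · rw [integral_add (hfi.const_mul a) (integrable_const b), integral_const_mul, hfint]
      simpa using hab
  have h1 : ∀ m : ℕ, _ := fun m => key 1 (-c - 1 / ((m : ℝ) + 1))
    (by have : (0:ℝ) < 1 / ((m : ℝ) + 1) := by positivity
        linarith)
  have h2 : ∀ m : ℕ, _ := fun m => key (-1) (c - 1 / ((m : ℝ) + 1))
    (by have : (0:ℝ) < 1 / ((m : ℝ) + 1) := by positivity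
        linarith)
  filter_upwards [ae_all_iff.2 h1, ae_all_iff.2 h2] with x hx1 hx2
  rw [Metric.tendsto_atTop']
  intro ε hε
  obtain ⟨m, hm⟩ := exists_nat_one_div_lt (half_pos hε)
  obtain ⟨M1, hM1⟩ := hx1 m
  obtain ⟨M2, hM2⟩ := hx2 m
  obtain ⟨N, hN⟩ := exists_nat_gt ((max M1 M2) / (ε / 2))
  refine ⟨N, fun n hn => ?_⟩
  have hn0 : (0:ℝ) < n := by
    have : 0 < n := by omega
    exact_mod_cast this
  have hNn : (N : ℝ) < n := by exact_mod_cast hn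
  have a1 := hM1 ⟨n, rfl⟩
  have a2 := hM2 ⟨n, rfl⟩
  simp only [birk_affine] at a1 a2
  have hN' := (div_lt_iff₀ (half_pos hε)).1 (hN.trans hNn)
  have b1 := le_max_left M1 M2
  have b2 := le_max_right M1 M2
  have hmn := mul_lt_mul_of_pos_left hm hn0
  rw [Real.dist_eq, freq_eq, abs_lt]
  constructor
  · have : c - ε < birkhoffSum T f n x / n := by
      rw [lt_div_iff₀ hn0]; nlinarith
    linarith
  · have : birkhoffSum T f n x / n < c + ε := by
      rw [div_lt_iff₀ hn0]; nlinarith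
    linarith

theorem digit_frequencies_eq_measure (μ : Measure ℝ) [IsProbabilityMeasure μ]
    (hsupp : μ (Set.Ico (0 : ℝ) 1)ᶜ = 0)
    (hinv : ∀ A : Set ℝ, MeasurableSet A → μ (T ⁻¹' A) = μ A)
    (hac : μ ≪ volume) :
    ∀ᵐ x ∂(volume.restrict (Set.Ico (0 : ℝ) 1)),
      Tendsto (fun n => freq x I1 n) atTop (nhds (μ I1).toReal) ∧
      Tendsto (fun n => freq x I2 n) atTop (nhds (μ I2).toReal) ∧
      Tendsto (fun n => freq x I3 n) atTop (nhds (μ I3).toReal) := by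
  have hT : MeasurePreserving T μ μ := by
    refine ⟨T_meas, Measure.ext fun A hA => ?_⟩
    rw [Measure.map_apply T_meas hA, hinv A hA]
  filter_upwards [freq_tendsto μ hT hsupp hac I1 measurableSet_Ico,
    freq_tendsto μ hT hsupp hac I2 measurableSet_Ico,
    freq_tendsto μ hT hsupp hac I3 measurableSet_Ico] with x h1 h2 h3
  exact ⟨h1, h2, h3⟩
end
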